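/- Let v(n) := max_{w ∈ 𝓛_n} Υ_w be the largest principal specialization of a Schubert polynomial over layered permutations of size n. Then the limit lim_{n→∞} (1/n²) · log v(n) exists and equals γ := f(α)/(1−α²), where α is the unique solution in (0,1) of the equation 2x·f(x) + (1−x²)·f′(x) = 0. -/

import Mathlib

/-- The simple transposition `sᵢ = (i, i+1)` acting on `ℕ` (positions are 1-indexed,
so a permutation of `{1,…,n}` is modeled as a permutation of `ℕ` fixing `0` and all `i > n`). -/
def sT (i : ℕ) : Equiv.Perm ℕ := Equiv.swap i (i + 1)

/-- The number of inversions `ℓ(w)` of `w` on `{1,…,n}`. -/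
def len (n : ℕ) (w : Equiv.Perm ℕ) : ℕ :=
  ((Finset.Icc 1 n ×ˢ Finset.Icc 1 n).filter
    (fun p => p.1 < p.2 ∧ w p.2 < w p.1)).card

open scoped Classical in
/-- Macdonald's identity form of the principal specialization `𝔖_w(1,…,1)` of the
Schubert polynomial: `Υ_w = (1/ℓ!) ⬝ Σ_{(a₁,…,a_ℓ) ∈ R(w)} a₁ a₂ ⋯ a_ℓ`, where the sum is
over reduced words of `w`, i.e. tuples with `1 ≤ aᵢ ≤ n − 1` and `w = s_{a₁} ⋯ s_{a_ℓ}`. -/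
noncomputable def Upsilon (n : ℕ) (w : Equiv.Perm ℕ) : ℚ :=
  ((len n w).factorial : ℚ)⁻¹ *
    ∑ a ∈ Finset.univ.filter (fun a : Fin (len n w) → Fin n =>
        (∀ i, 1 ≤ (a i : ℕ)) ∧ (List.ofFn fun i => sT ((a i : ℕ))).prod = w),
      ∏ i, ((a i : ℕ) : ℚ)

/-- Reversal of the block of positions `s+1, …, s+c`, as a permutation of `ℕ`. -/
def blockRev (s c : ℕ) : Equiv.Perm ℕ :=
  ((List.range (c / 2)).map fun i => Equiv.swap (s + i + 1) (s + c - i)).prod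

/-- The layered permutation `w(b_k, …, b_1)` whose blocks, read left to right,
are given by the list `b = [b_k, …, b_1]`: it reverses the consecutive blocks of
positions of sizes `b_k, b_{k−1}, …, b_1`. -/
def layeredPerm (b : List ℕ) : Equiv.Perm ℕ :=
  ((List.range b.length).map fun j => blockRev ((b.take j).sum) (b.getD j 0)).prod

/-- `𝓛ₙ`: the set of layered permutations in `S_n`. -/
def LayeredSet (n : ℕ) : Set (Equiv.Perm ℕ) :=
  {w | ∃ b : List ℕ, (∀ c ∈ b, 0 < c) ∧ b.sum = n ∧ w = layeredPerm b}

/-- `v(n) = max_{w ∈ 𝓛ₙ} Υ_w` (as a real number; the set is finite and nonempty,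
so the supremum is attained). -/
noncomputable def v (n : ℕ) : ℝ :=
  sSup ((fun w => ((Upsilon n w : ℚ) : ℝ)) '' LayeredSet n)

/-- The function `f(x) = x² log x − ½(1−x)² log(1−x) − ½(1+x)² log(1+x) + 2x log 2`
(natural logarithms; `Real.log 0 = 0` gives the continuous extension `f 0 = f 1 = 0`). -/
noncomputable def f (x : ℝ) : ℝ :=
  x ^ 2 * Real.log x - (1 / 2) * (1 - x) ^ 2 * Real.log (1 - x)
    - (1 / 2) * (1 + x) ^ 2 * Real.log (1 + x) + 2 * x * Real.log 2

namespace Layered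

lemma sT_apply (i x : ℕ) :
    sT i x = if x = i then i + 1 else if x = i + 1 then i else x := by
  simp only [sT, Equiv.swap_apply_def]

lemma sT_mul_self (i : ℕ) : sT i * sT i = 1 := Equiv.swap_mul_self _ _

lemma mul_sT_mul_sT (w : Equiv.Perm ℕ) (i : ℕ) : w * sT i * sT i = w := by
  rw [mul_assoc, sT_mul_self, mul_one]

lemma mul_sT_apply_left (w : Equiv.Perm ℕ) (i : ℕ) : (w * sT i) i = w (i + 1) := by
  simp [sT]

lemma mul_sT_apply_right (w : Equiv.Perm ℕ) (i : ℕ) : (w * sT i) (i + 1) = w i := by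
  simp [sT]

lemma mul_sT_apply_of_ne (w : Equiv.Perm ℕ) {i x : ℕ} (h : x ≠ i) (h' : x ≠ i + 1) :
    (w * sT i) x = w x := by
  simp [sT_apply, h, h']

lemma len_mul_sT_of_asc {n i : ℕ} (w : Equiv.Perm ℕ) (hi : 1 ≤ i) (hn : i < n)
    (h : w i < w (i + 1)) : len n (w * sT i) = len n w + 1 := by
  classical
  unfold len
  have key : ((Finset.Icc 1 n ×ˢ Finset.Icc 1 n).filter
      (fun p => p.1 < p.2 ∧ (w * sT i) p.2 < (w * sT i) p.1)) =
      insert (i, i + 1) (((Finset.Icc 1 n ×ˢ Finset.Icc 1 n).filter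
      (fun p => p.1 < p.2 ∧ w p.2 < w p.1)).map
        ((sT i).prodCongr (sT i)).toEmbedding) := by
    ext ⟨a, b⟩
    rw [Finset.mem_filter, Finset.mem_insert]
    simp only [Finset.mem_filter, Finset.mem_product, Finset.mem_Icc,
      Finset.mem_map, Prod.exists, Prod.mk.injEq, Equiv.Perm.mul_apply,
      Equiv.coe_toEmbedding, Equiv.prodCongr_apply, Prod.map_apply]
    constructor
    · rintro ⟨⟨⟨ha, ha'⟩, hb, hb'⟩, hab, hw⟩
      by_cases e : a = i ∧ b = i + 1
      · exact Or.inl e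
      · right
        refine ⟨sT i a, sT i b, ⟨⟨⟨?_, ?_⟩, ?_, ?_⟩, ?_, hw⟩, ?_, ?_⟩
        all_goals first
          | (simp [sT]; done)
          | (simp only [sT_apply]; split_ifs <;> omega)
    · rintro (⟨rfl, rfl⟩ | ⟨c, d, ⟨⟨⟨hc, hc'⟩, hd, hd'⟩, hcd, hw⟩, rfl, rfl⟩)
      · refine ⟨⟨⟨hi, hn.le⟩, by omega, by omega⟩, by omega, ?_⟩
        simpa [sT] using h
      · have hne : ¬ (c = i ∧ d = i + 1) := by
          rintro ⟨rfl, rfl⟩; exact absurd hw (not_lt.mpr h.le)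
        refine ⟨⟨⟨?_, ?_⟩, ?_, ?_⟩, ?_, ?_⟩
        all_goals first
          | (simpa [sT] using hw)
          | (simp only [sT_apply]; split_ifs <;> omega)
  rw [key, Finset.card_insert_of_notMem, Finset.card_map]
  simp only [Finset.mem_map, Finset.mem_filter, Prod.exists, not_exists, Equiv.coe_toEmbedding,
    Equiv.prodCongr_apply, Prod.map_apply, Prod.mk.injEq, Finset.mem_product]
  rintro c d ⟨⟨-, hcd, -⟩, h1, h2⟩
  rw [sT_apply] at h1 h2
  split_ifs at h1 h2 <;> omega

lemma len_mul_sT_of_desc {n i : ℕ} (w : Equiv.Perm ℕ) (hi : 1 ≤ i) (hn : i < n)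
    (h : w (i + 1) < w i) : len n (w * sT i) + 1 = len n w := by
  have := len_mul_sT_of_asc (w * sT i) hi hn
    (by rwa [mul_sT_apply_left, mul_sT_apply_right])
  rw [mul_sT_mul_sT] at this
  exact this.symm

lemma asc_or_desc (w : Equiv.Perm ℕ) (i : ℕ) : w i < w (i + 1) ∨ w (i + 1) < w i := by
  rcases lt_trichotomy (w i) (w (i + 1)) with h | h | h
  · exact Or.inl h
  · exact absurd (w.injective h) (by omega)
  · exact Or.inr h

open scoped Classical in
/-- The weighted number of words of length `k` with product `w`. -/
noncomputable def wordSum (n k : ℕ) (w : Equiv.Perm ℕ) : ℚ :=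
  ∑ a ∈ Finset.univ.filter (fun a : Fin k → Fin n =>
        (∀ i, 1 ≤ (a i : ℕ)) ∧ (List.ofFn fun i => sT ((a i : ℕ))).prod = w),
      ∏ i, ((a i : ℕ) : ℚ)

lemma upsilon_eq (n : ℕ) (w : Equiv.Perm ℕ) :
    Upsilon n w = ((len n w).factorial : ℚ)⁻¹ * wordSum n (len n w) w := rfl

open scoped Classical in
lemma wordSum_zero (n : ℕ) (w : Equiv.Perm ℕ) : wordSum n 0 w = if w = 1 then 1 else 0 := by
  unfold wordSum
  by_cases h : w = 1
  · simp [h]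
  · simp [h, Ne.symm h]

lemma wordSum_succ (n k : ℕ) (w : Equiv.Perm ℕ) :
    wordSum n (k + 1) w = ∑ i ∈ Finset.Ico 1 n, (i : ℚ) * wordSum n k (w * sT i) := by
  classical
  unfold wordSum
  have hR : ∑ i ∈ Finset.Ico 1 n, (i : ℚ) * (∑ a ∈ Finset.univ.filter (fun a : Fin k → Fin n =>
        (∀ i, 1 ≤ (a i : ℕ)) ∧ (List.ofFn fun i => sT ((a i : ℕ))).prod = w * sT i),
      ∏ i, ((a i : ℕ) : ℚ)) = ∑ i : Fin n, if 1 ≤ (i : ℕ) then (i : ℚ) *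
        (∑ a ∈ Finset.univ.filter (fun a : Fin k → Fin n =>
        (∀ i, 1 ≤ (a i : ℕ)) ∧ (List.ofFn fun i => sT ((a i : ℕ))).prod = w * sT i),
      ∏ i, ((a i : ℕ) : ℚ)) else 0 := by
    rw [Fin.sum_univ_eq_sum_range (fun i => if 1 ≤ i then (i : ℚ) *
        (∑ a ∈ Finset.univ.filter (fun a : Fin k → Fin n =>
        (∀ i, 1 ≤ (a i : ℕ)) ∧ (List.ofFn fun i => sT ((a i : ℕ))).prod = w * sT i),
      ∏ i, ((a i : ℕ) : ℚ)) else 0) n, ← Finset.sum_filter]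
    refine Finset.sum_congr ?_ fun _ _ => rfl
    ext x; simp; tauto
  rw [hR, Finset.sum_filter,
    ← (Fin.snocEquiv (fun _ : Fin (k + 1) => Fin n)).sum_comp, Fintype.sum_prod_type]
  refine Finset.sum_congr rfl fun i _ => ?_
  split_ifs with hi
  · rw [Finset.mul_sum, Finset.sum_filter]
    refine Finset.sum_congr rfl fun a _ => ?_
    have hprod : (List.ofFn fun j : Fin (k + 1) =>
        sT ((Fin.snoc (α := fun _ => Fin n) a i j : Fin n) : ℕ)).prod =
        (List.ofFn fun j => sT ((a j : ℕ))).prod * sT i := by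
      rw [List.ofFn_succ', List.concat_eq_append, List.prod_append]
      simp
    have hiff : ((∀ j, 1 ≤ ((Fin.snoc (α := fun _ => Fin n) a i j : Fin n) : ℕ)) ∧
        (List.ofFn fun j : Fin (k + 1) =>
        sT ((Fin.snoc (α := fun _ => Fin n) a i j : Fin n) : ℕ)).prod = w) ↔
        ((∀ i, 1 ≤ (a i : ℕ)) ∧ (List.ofFn fun i => sT ((a i : ℕ))).prod = w * sT i) := by
      rw [hprod, Fin.forall_fin_succ']
      simp only [Fin.snoc_castSucc, Fin.snoc_last]
      constructor
      · rintro ⟨⟨h1, -⟩, rfl⟩; exact ⟨h1, (mul_sT_mul_sT _ _).symm⟩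
      · rintro ⟨h1, h2⟩; exact ⟨⟨h1, hi⟩, by rw [h2, mul_sT_mul_sT]⟩
    change (if ((∀ j, 1 ≤ ((Fin.snoc (α := fun _ => Fin n) a i j : Fin n) : ℕ)) ∧
        (List.ofFn fun j : Fin (k + 1) =>
        sT ((Fin.snoc (α := fun _ => Fin n) a i j : Fin n) : ℕ)).prod = w) then
        ∏ j, (((Fin.snoc (α := fun _ => Fin n) a i j : Fin n) : ℕ) : ℚ) else 0) = _
    rw [if_congr hiff rfl rfl, Fin.prod_univ_castSucc]
    simp only [Fin.snoc_castSucc, Fin.snoc_last, mul_comm]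
  · refine Finset.sum_eq_zero fun a _ => ?_
    rw [if_neg]
    rintro ⟨h, -⟩
    apply hi
    simpa [Fin.snocEquiv] using h (Fin.last k)

lemma wordSum_eq_zero {n k : ℕ} (w : Equiv.Perm ℕ) (h : k < len n w) : wordSum n k w = 0 := by
  induction k generalizing w with
  | zero =>
    rw [wordSum_zero, if_neg]
    rintro rfl
    have : len n 1 = 0 := by
      unfold len
      rw [Finset.card_eq_zero, Finset.filter_eq_empty_iff]
      rintro p - ⟨h1, h2⟩
      simp at h2; omega
    omega
  | succ k ih =>
    rw [wordSum_succ]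
    refine Finset.sum_eq_zero fun i hi => ?_
    rw [Finset.mem_Ico] at hi
    rw [ih, mul_zero]
    rcases asc_or_desc w i with h' | h'
    · have := len_mul_sT_of_asc w hi.1 hi.2 h'; omega
    · have := len_mul_sT_of_desc w hi.1 hi.2 h'; omega

lemma len_one (n : ℕ) : len n 1 = 0 := by
  unfold len
  rw [Finset.card_eq_zero, Finset.filter_eq_empty_iff]
  rintro p - ⟨h1, h2⟩
  simp at h2; omega

lemma upsilon_one (n : ℕ) : Upsilon n 1 = 1 := by
  rw [upsilon_eq, len_one, wordSum_zero]; simp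

/-- Macdonald's recursion on the descents of `w`. -/
lemma len_mul_upsilon (n : ℕ) (w : Equiv.Perm ℕ) (h0 : len n w ≠ 0) :
    (len n w : ℚ) * Upsilon n w =
      ∑ i ∈ (Finset.Ico 1 n).filter (fun i => w (i + 1) < w i), (i : ℚ) * Upsilon n (w * sT i) := by
  obtain ⟨k, hk⟩ := Nat.exists_eq_succ_of_ne_zero h0
  have hk' : len n w = k + 1 := hk
  rw [upsilon_eq, hk', wordSum_succ, Finset.sum_filter, Finset.mul_sum, Finset.mul_sum]
  refine Finset.sum_congr rfl fun i hi => ?_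
  rw [Finset.mem_Ico] at hi
  split_ifs with h
  · have h1 : len n (w * sT i) = k := by have := len_mul_sT_of_desc w hi.1 hi.2 h; omega
    rw [upsilon_eq, h1, Nat.factorial_succ]
    push_cast
    have : (k.factorial : ℚ) ≠ 0 := by positivity
    have : (k : ℚ) + 1 ≠ 0 := by positivity
    field_simp
  · have h2 : w i < w (i + 1) := (asc_or_desc w i).resolve_right h
    rw [wordSum_eq_zero]
    · simp
    · have := len_mul_sT_of_asc w hi.1 hi.2 h2; omega

/-- Permutations supported on `(s, n]`. -/
def Supp (s n : ℕ) (w : Equiv.Perm ℕ) : Prop := ∀ x, (x ≤ s ∨ n < x) → w x = x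

lemma Supp.mul {s n : ℕ} {w u : Equiv.Perm ℕ} (hw : Supp s n w) (hu : Supp s n u) :
    Supp s n (w * u) := fun x hx => by rw [Equiv.Perm.mul_apply, hu x hx, hw x hx]

lemma supp_sT {s n i : ℕ} (hi : s < i) (hn : i < n) : Supp s n (sT i) := fun x hx => by
  rw [sT_apply]; split_ifs <;> omega

lemma Supp.mul_sT {s n i : ℕ} {w : Equiv.Perm ℕ} (hw : Supp s n w) (hi : s < i) (hn : i < n) :
    Supp s n (w * sT i) := hw.mul (supp_sT hi hn)

lemma Supp.map_mem {s n : ℕ} {w : Equiv.Perm ℕ} (hw : Supp s n w) {x : ℕ} (h : s < x)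
    (h' : x ≤ n) : s < w x ∧ w x ≤ n := by
  by_contra hc
  have : w (w x) = w x := hw _ (by omega)
  have := w.injective this
  omega

/-- A permutation of `{1, …, n}` without descents is the identity. -/
lemma Supp.eq_one {n : ℕ} {w : Equiv.Perm ℕ} (hw : Supp 0 n w)
    (h : ∀ i, 1 ≤ i → i < n → w i < w (i + 1)) : w = 1 := by
  have h1 : ∀ x, x ≤ n → x ≤ w x := by
    intro x
    induction x with
    | zero => intro; omega
    | succ x ih =>
      intro hx
      rcases Nat.eq_zero_or_pos x with rfl | h0
      · exact (hw.map_mem (x := 1) (by omega) (by omega)).1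
      · have := h x h0 (by omega); have := ih (by omega); omega
  have h2 : ∀ k, k < n → w (n - k) ≤ n - k := by
    intro k
    induction k with
    | zero => intro hk; exact (hw.map_mem (x := n) (by omega) (by omega)).2
    | succ k ih =>
      intro hk
      have := h (n - (k + 1)) (by omega) (by omega)
      rw [show n - (k + 1) + 1 = n - k by omega] at this
      have := ih (by omega); omega
  ext x
  by_cases hx : x ≤ 0 ∨ n < x
  · exact hw x hx
  · have := h1 x (by omega)
    have := h2 (n - x) (by omega)
    rw [show n - (n - x) = x by omega] at this
    simp; omega

lemma Supp.eq_one_of_len {n : ℕ} {w : Equiv.Perm ℕ} (hw : Supp 0 n w) (h : len n w = 0) :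
    w = 1 := by
  apply hw.eq_one
  intro i h1 h2
  rcases asc_or_desc w i with h' | h'
  · exact h'
  · have := len_mul_sT_of_desc w h1 h2 h'; omega

end Layered

namespace Layered

open MvPolynomial

/-- The action of `sᵢ` on polynomials in the variables `X 1, X 2, …`. -/
noncomputable def sw (i : ℕ) : MvPolynomial ℕ ℚ →ₐ[ℚ] MvPolynomial ℕ ℚ := rename (sT i)

@[simp] lemma sw_X (i x : ℕ) : sw i (X x) = X (sT i x) := by simp [sw]

@[simp] lemma sw_sw (i : ℕ) (P : MvPolynomial ℕ ℚ) : sw i (sw i P) = P := by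
  rw [sw, rename_rename, ← Equiv.Perm.coe_mul, sT_mul_self, Equiv.Perm.coe_one, rename_id_apply]

lemma sw_X_left (i : ℕ) : sw i (X i) = X (i + 1) := by simp [sT]

lemma sw_X_right (i : ℕ) : sw i (X (i + 1)) = X i := by simp [sT]

lemma sw_X_of_ne {i x : ℕ} (h : x ≠ i) (h' : x ≠ i + 1) : sw i (X x) = X x := by
  simp [sT_apply, h, h']

lemma X_sub_X_ne_zero {i j : ℕ} (h : i ≠ j) : (X i - X j : MvPolynomial ℕ ℚ) ≠ 0 :=
  sub_ne_zero.mpr fun e => h (X_injective e)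

lemma exists_divided_difference (i : ℕ) (P : MvPolynomial ℕ ℚ) :
    ∃ Q, (X i - X (i + 1)) * Q = P - sw i P := by
  induction P using MvPolynomial.induction_on with
  | C a => exact ⟨0, by simp [sw]⟩
  | add p q hp hq =>
    obtain ⟨a, ha⟩ := hp
    obtain ⟨b, hb⟩ := hq
    exact ⟨a + b, by rw [mul_add, ha, hb, map_add]; ring⟩
  | mul_X p x hp =>
    obtain ⟨a, ha⟩ := hp
    rw [map_mul]
    by_cases h : x = i
    · subst h
      exact ⟨X (x + 1) * a + p, by rw [sw_X_left]; linear_combination X (x + 1) * ha⟩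
    by_cases h' : x = i + 1
    · subst h'
      exact ⟨X i * a - p, by rw [sw_X_right]; linear_combination X i * ha⟩
    · exact ⟨a * X x, by rw [sw_X_of_ne h h', ← sub_mul, ← ha]; ring⟩

/-- The divided difference `(P - sᵢ P) / (X i - X (i + 1))`. -/
noncomputable def dd (i : ℕ) (P : MvPolynomial ℕ ℚ) : MvPolynomial ℕ ℚ :=
  (exists_divided_difference i P).choose

lemma dd_spec (i : ℕ) (P : MvPolynomial ℕ ℚ) : (X i - X (i + 1)) * dd i P = P - sw i P :=
  (exists_divided_difference i P).choose_spec

lemma dd_eq {i : ℕ} {P Q : MvPolynomial ℕ ℚ} (h : (X i - X (i + 1)) * Q = P - sw i P) :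
    dd i P = Q :=
  mul_left_cancel₀ (X_sub_X_ne_zero (by omega)) ((dd_spec i P).trans h.symm)

lemma dd_add (i : ℕ) (P Q : MvPolynomial ℕ ℚ) : dd i (P + Q) = dd i P + dd i Q :=
  dd_eq (by rw [mul_add, dd_spec, dd_spec, map_add]; ring)

lemma dd_smul (i : ℕ) (c : ℚ) (P : MvPolynomial ℕ ℚ) : dd i (c • P) = c • dd i P :=
  dd_eq (by rw [mul_smul_comm, dd_spec, map_smul, smul_sub])

/-- `dd i` as a linear map. -/
noncomputable def ddL (i : ℕ) : MvPolynomial ℕ ℚ →ₗ[ℚ] MvPolynomial ℕ ℚ where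
  toFun := dd i
  map_add' := dd_add i
  map_smul' := dd_smul i

lemma ddL_apply (i : ℕ) (P : MvPolynomial ℕ ℚ) : ddL i P = dd i P := rfl

lemma dd_zero (i : ℕ) : dd i 0 = 0 := (ddL i).map_zero

lemma dd_sum {ι : Type*} (i : ℕ) (s : Finset ι) (P : ι → MvPolynomial ℕ ℚ) :
    dd i (∑ j ∈ s, P j) = ∑ j ∈ s, dd i (P j) := map_sum (ddL i) P s

lemma dd_mul_of_sw_eq {i : ℕ} {P : MvPolynomial ℕ ℚ} (h : sw i P = P) (Q : MvPolynomial ℕ ℚ) :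
    dd i (P * Q) = P * dd i Q :=
  dd_eq (by rw [map_mul, h]; linear_combination P * dd_spec i Q)

lemma dd_dd (i : ℕ) (P : MvPolynomial ℕ ℚ) : dd i (dd i P) = 0 := by
  apply dd_eq
  have h1 := dd_spec i P
  have h2 := congrArg (sw i) h1
  simp only [map_mul, map_sub, sw_X_left, sw_X_right, sw_sw] at h2
  have : (X i - X (i + 1)) * (dd i P - sw i (dd i P)) = 0 := by linear_combination h1 + h2
  rw [mul_zero]
  exact ((mul_eq_zero.mp this).resolve_left (X_sub_X_ne_zero (by omega))).symm

lemma sw_comm {i j : ℕ} (h : i + 1 < j) (P : MvPolynomial ℕ ℚ) :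
    sw i (sw j P) = sw j (sw i P) := by
  simp only [sw, rename_rename]
  congr 1
  congr 1
  funext x
  simp only [Function.comp_apply, sT_apply]
  split_ifs <;> omega

lemma sw_braid (i : ℕ) (P : MvPolynomial ℕ ℚ) :
    sw i (sw (i + 1) (sw i P)) = sw (i + 1) (sw i (sw (i + 1) P)) := by
  simp only [sw, rename_rename]
  congr 1
  congr 1
  funext x
  simp only [Function.comp_apply, sT_apply]
  split_ifs <;> omega

lemma dd_comm {i j : ℕ} (h : i + 1 < j) (P : MvPolynomial ℕ ℚ) :
    dd i (dd j P) = dd j (dd i P) := by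
  apply dd_eq
  have hi := dd_spec i P
  have hj := dd_spec j P
  have hij := dd_spec j (dd i P)
  have h1 := congrArg (sw j) hi
  have h2 := congrArg (sw i) hj
  simp only [map_mul, map_sub, sw_X_of_ne (show i ≠ j by omega) (show i ≠ j + 1 by omega),
    sw_X_of_ne (show i + 1 ≠ j by omega) (show i + 1 ≠ j + 1 by omega)] at h1
  simp only [map_mul, map_sub, sw_X_of_ne (show j ≠ i by omega) (show j ≠ i + 1 by omega),
    sw_X_of_ne (show j + 1 ≠ i by omega) (show j + 1 ≠ i + 1 by omega), sw_comm h] at h2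
  apply mul_left_cancel₀ (X_sub_X_ne_zero (show j ≠ j + 1 by omega))
  linear_combination (X i - X (i + 1)) * hij + hi - h1 - hj + h2

/-- `dd i (dd (i + 1) (dd i P))` and its mirror image are both the antisymmetrization of `P` in
three consecutive variables divided by the Vandermonde product. -/
lemma dd_braid (i : ℕ) (P : MvPolynomial ℕ ℚ) :
    dd i (dd (i + 1) (dd i P)) = dd (i + 1) (dd i (dd (i + 1) P)) := by
  have e1 : sw i (X (i + 1 + 1)) = X (i + 1 + 1) := sw_X_of_ne (by omega) (by omega)
  have e2 : sw (i + 1) (X i) = X i := sw_X_of_ne (by omega) (by omega)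
  have a1 := dd_spec i P
  have a2 := dd_spec (i + 1) (dd i P)
  have a3 := dd_spec i (dd (i + 1) (dd i P))
  have a1' := congrArg (sw (i + 1)) a1
  simp only [map_mul, map_sub, sw_X_left, e2] at a1'
  have a2' := congrArg (sw i) a2
  simp only [map_mul, map_sub, sw_X_right, e1] at a2'
  have a1'' := congrArg (sw i) a1'
  simp only [map_mul, map_sub, sw_X_left, e1] at a1''
  have a0' := congrArg (sw i) a1
  simp only [map_mul, map_sub, sw_X_left, sw_X_right, sw_sw] at a0'
  have b1 := dd_spec (i + 1) P
  have b2 := dd_spec i (dd (i + 1) P)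
  have b3 := dd_spec (i + 1) (dd i (dd (i + 1) P))
  have b1' := congrArg (sw i) b1
  simp only [map_mul, map_sub, sw_X_right, e1] at b1'
  have b2' := congrArg (sw (i + 1)) b2
  simp only [map_mul, map_sub, sw_X_left, e2] at b2'
  have b1'' := congrArg (sw (i + 1)) b1'
  simp only [map_mul, map_sub, sw_X_right, e2, ← sw_braid] at b1''
  have b0' := congrArg (sw (i + 1)) b1
  simp only [map_mul, map_sub, sw_X_left, sw_X_right, sw_sw] at b0'
  have hab : (X i - X (i + 1) : MvPolynomial ℕ ℚ) ≠ 0 := X_sub_X_ne_zero (by omega)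
  have hbc : (X (i + 1) - X (i + 1 + 1) : MvPolynomial ℕ ℚ) ≠ 0 := X_sub_X_ne_zero (by omega)
  have hac : (X i - X (i + 1 + 1) : MvPolynomial ℕ ℚ) ≠ 0 := X_sub_X_ne_zero (by omega)
  have A : (X i - X (i + 1)) * (X (i + 1) - X (i + 1 + 1)) * (X i - X (i + 1 + 1)) *
      dd i (dd (i + 1) (dd i P)) = P - sw i P - sw (i + 1) P + sw (i + 1) (sw i P) +
        sw i (sw (i + 1) P) - sw i (sw (i + 1) (sw i P)) := by
    apply mul_left_cancel₀ hab
    linear_combination (X i - X (i + 1)) * (X (i + 1) - X (i + 1 + 1)) * (X i - X (i + 1 + 1)) *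
      a3 + (X i - X (i + 1)) * (X i - X (i + 1 + 1)) * a2 - (X i - X (i + 1)) *
      (X (i + 1) - X (i + 1 + 1)) * a2' +
      (X i - X (i + 1 + 1)) * a1 - (X i - X (i + 1)) * a1' + (X (i + 1) - X (i + 1 + 1)) *
      a0' + (X i - X (i + 1)) * a1''
  have B : (X i - X (i + 1)) * (X (i + 1) - X (i + 1 + 1)) * (X i - X (i + 1 + 1)) *
      dd (i + 1) (dd i (dd (i + 1) P)) = P - sw i P - sw (i + 1) P + sw (i + 1) (sw i P) +
        sw i (sw (i + 1) P) - sw i (sw (i + 1) (sw i P)) := by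
    apply mul_left_cancel₀ hbc
    linear_combination (X i - X (i + 1)) * (X (i + 1) - X (i + 1 + 1)) * (X i - X (i + 1 + 1)) *
      b3 + (X (i + 1) - X (i + 1 + 1)) * (X i - X (i + 1 + 1)) * b2 - (X i - X (i + 1)) *
      (X (i + 1) - X (i + 1 + 1)) * b2' +
      (X i - X (i + 1 + 1)) * b1 - (X (i + 1) - X (i + 1 + 1)) * b1' + (X i - X (i + 1)) *
      b0' + (X (i + 1) - X (i + 1 + 1)) * b1''
  exact mul_left_cancel₀ (mul_ne_zero (mul_ne_zero hab hbc) hac) (A.trans B.symm)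

/-- The monomial with exponents `a` in the variables `X 1, …, X N`. -/
noncomputable def mono (N : ℕ) (a : ℕ → ℕ) : MvPolynomial ℕ ℚ := ∏ x ∈ Finset.Icc 1 N, X x ^ a x

lemma mono_split {N i : ℕ} (hi : 1 ≤ i) (hN : i < N) (a : ℕ → ℕ) :
    mono N a = X i ^ a i * X (i + 1) ^ a (i + 1) *
      ∏ x ∈ (Finset.Icc 1 N).filter (fun x => x ≠ i ∧ x ≠ i + 1), X x ^ a x := by
  unfold mono
  rw [← Finset.prod_filter_mul_prod_filter_not (Finset.Icc 1 N) (fun x => x ≠ i ∧ x ≠ i + 1),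
    mul_comm]
  congr 1
  have : (Finset.Icc 1 N).filter (fun x => ¬ (x ≠ i ∧ x ≠ i + 1)) = {i, i + 1} := by
    ext x; simp only [Finset.mem_filter, Finset.mem_Icc, Finset.mem_insert, Finset.mem_singleton]
    omega
  rw [this, Finset.prod_pair (by omega)]

/-- Exponents of the terms of the divided difference of a monomial. -/
def ddExp (a : ℕ → ℕ) (i u v x : ℕ) : ℕ := if x = i then u else if x = i + 1 then v else a x

lemma mono_ddExp {N i : ℕ} (hi : 1 ≤ i) (hN : i < N) (a : ℕ → ℕ) (u v : ℕ) :
    mono N (ddExp a i u v) = X i ^ u * X (i + 1) ^ v *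
      ∏ x ∈ (Finset.Icc 1 N).filter (fun x => x ≠ i ∧ x ≠ i + 1), X x ^ a x := by
  rw [mono_split hi hN]
  congr 1
  · simp [ddExp]
  · refine Finset.prod_congr rfl fun x hx => ?_
    rw [Finset.mem_filter] at hx
    simp [ddExp, hx.2.1, hx.2.2]

lemma sw_rest (N i : ℕ) (a : ℕ → ℕ) :
    sw i (∏ x ∈ (Finset.Icc 1 N).filter (fun x => x ≠ i ∧ x ≠ i + 1), X x ^ a x) =
      ∏ x ∈ (Finset.Icc 1 N).filter (fun x => x ≠ i ∧ x ≠ i + 1), X x ^ a x := by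
  rw [map_prod]
  refine Finset.prod_congr rfl fun x hx => ?_
  rw [Finset.mem_filter] at hx
  rw [map_pow, sw_X_of_ne hx.2.1 hx.2.2]

lemma dd_mono_of_ge {N i : ℕ} (hi : 1 ≤ i) (hN : i < N) (a : ℕ → ℕ) {b c : ℕ}
    (h : a i = b + c) (h' : a (i + 1) = b) :
    dd i (mono N a) =
      ∑ t ∈ Finset.range c, mono N (ddExp a i (b + t) (b + (c - 1 - t))) := by
  have hg := geom_sum₂_mul (X i : MvPolynomial ℕ ℚ) (X (i + 1)) c
  apply dd_eq
  simp only [mono_ddExp hi hN, mono_split hi hN a, map_mul, sw_rest, map_pow, sw_X_left,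
    sw_X_right, h, h']
  rw [← Finset.sum_mul]
  have : ∑ t ∈ Finset.range c, (X i ^ (b + t) * X (i + 1) ^ (b + (c - 1 - t)) :
      MvPolynomial ℕ ℚ) = X i ^ b * X (i + 1) ^ b *
        ∑ t ∈ Finset.range c, X i ^ t * X (i + 1) ^ (c - 1 - t) := by
    rw [Finset.mul_sum]
    exact Finset.sum_congr rfl fun t _ => by ring
  rw [this, pow_add, pow_add]
  linear_combination (X i ^ b * X (i + 1) ^ b *
    ∏ x ∈ (Finset.Icc 1 N).filter (fun x => x ≠ i ∧ x ≠ i + 1), X x ^ a x) * hg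

lemma dd_mono_of_le {N i : ℕ} (hi : 1 ≤ i) (hN : i < N) (a : ℕ → ℕ) {b c : ℕ}
    (h : a i = b) (h' : a (i + 1) = b + c) :
    dd i (mono N a) =
      -∑ t ∈ Finset.range c, mono N (ddExp a i (b + t) (b + (c - 1 - t))) := by
  have hg := geom_sum₂_mul (X i : MvPolynomial ℕ ℚ) (X (i + 1)) c
  apply dd_eq
  simp only [mono_ddExp hi hN, mono_split hi hN a, map_mul, sw_rest, map_pow, sw_X_left,
    sw_X_right, h, h']
  rw [← Finset.sum_mul]
  have : ∑ t ∈ Finset.range c, (X i ^ (b + t) * X (i + 1) ^ (b + (c - 1 - t)) :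
      MvPolynomial ℕ ℚ) = X i ^ b * X (i + 1) ^ b *
        ∑ t ∈ Finset.range c, X i ^ t * X (i + 1) ^ (c - 1 - t) := by
    rw [Finset.mul_sum]
    exact Finset.sum_congr rfl fun t _ => by ring
  rw [this, pow_add, pow_add]
  linear_combination -(X i ^ b * X (i + 1) ^ b *
    ∏ x ∈ (Finset.Icc 1 N).filter (fun x => x ≠ i ∧ x ≠ i + 1), X x ^ a x) * hg

lemma dd_mono_of_eq_add_one {N i : ℕ} (hi : 1 ≤ i) (hN : i < N) {a a' : ℕ → ℕ}
    (h : a i = a (i + 1) + 1) (h' : ∀ x, a' x = if x = i then a x - 1 else a x) :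
    dd i (mono N a) = mono N a' := by
  rw [dd_mono_of_ge hi hN a h rfl]
  simp only [Finset.sum_range_one]
  congr 1
  funext x
  rw [h', ddExp]
  split_ifs with h1 h2
  · subst h1; omega
  · subst h2; simp
  · rfl

/-- Evaluation at `X x = 1`. -/
noncomputable def ev : MvPolynomial ℕ ℚ →ₐ[ℚ] ℚ := aeval (fun _ => 1)

@[simp] lemma ev_mono (N : ℕ) (a : ℕ → ℕ) : ev (mono N a) = 1 := by
  simp [ev, mono, map_prod]

lemma ev_dd_mono {N i : ℕ} (hi : 1 ≤ i) (hN : i < N) (a : ℕ → ℕ) :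
    ev (dd i (mono N a)) = a i - a (i + 1) := by
  rcases le_total (a (i + 1)) (a i) with h | h
  · obtain ⟨c, hc⟩ := Nat.exists_eq_add_of_le h
    rw [dd_mono_of_ge hi hN a hc rfl, map_sum, hc]
    simp
  · obtain ⟨c, hc⟩ := Nat.exists_eq_add_of_le h
    rw [dd_mono_of_le hi hN a rfl hc, map_neg, map_sum, hc]
    simp

/-- The homogeneous polynomials of degree `d` spanned by the divisors of
`X 1 ^ (N - 1) * X 2 ^ (N - 2) ⋯`. -/
noncomputable def stair (N d : ℕ) : Submodule ℚ (MvPolynomial ℕ ℚ) :=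
  Submodule.span ℚ {P | ∃ a : ℕ → ℕ, (∀ x, a x ≤ N - x) ∧
    ∑ x ∈ Finset.Icc 1 N, a x = d ∧ P = mono N a}

lemma sum_ddExp {N i : ℕ} (hi : 1 ≤ i) (hN : i < N) (a : ℕ → ℕ) (u v : ℕ) :
    ∑ x ∈ Finset.Icc 1 N, ddExp a i u v x + (a i + a (i + 1)) =
      ∑ x ∈ Finset.Icc 1 N, a x + (u + v) := by
  have key : ∀ g : ℕ → ℕ, ∑ x ∈ Finset.Icc 1 N, g x =
      ∑ x ∈ (Finset.Icc 1 N).filter (fun x => x ≠ i ∧ x ≠ i + 1), g x + (g i + g (i + 1)) := by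
    intro g
    rw [← Finset.sum_filter_add_sum_filter_not (Finset.Icc 1 N) (fun x => x ≠ i ∧ x ≠ i + 1)]
    congr 1
    have : (Finset.Icc 1 N).filter (fun x => ¬ (x ≠ i ∧ x ≠ i + 1)) = {i, i + 1} := by
      ext x; simp only [Finset.mem_filter, Finset.mem_Icc, Finset.mem_insert, Finset.mem_singleton]
      omega
    rw [this, Finset.sum_pair (by omega)]
  rw [key a, key (ddExp a i u v)]
  have : ∑ x ∈ (Finset.Icc 1 N).filter (fun x => x ≠ i ∧ x ≠ i + 1), ddExp a i u v x =
      ∑ x ∈ (Finset.Icc 1 N).filter (fun x => x ≠ i ∧ x ≠ i + 1), a x := by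
    refine Finset.sum_congr rfl fun x hx => ?_
    rw [Finset.mem_filter] at hx
    simp [ddExp, hx.2.1, hx.2.2]
  rw [this]
  simp [ddExp]
  ring

lemma mono_ddExp_mem {N i d : ℕ} (hi : 1 ≤ i) (hN : i < N) {a : ℕ → ℕ}
    (ha : ∀ x, a x ≤ N - x) (hd : ∑ x ∈ Finset.Icc 1 N, a x = d) {u v : ℕ}
    (huv : u + v + 1 = a i + a (i + 1)) (hu : u < max (a i) (a (i + 1)))
    (hv : v < max (a i) (a (i + 1))) : mono N (ddExp a i u v) ∈ stair N (d - 1) := by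
  refine Submodule.subset_span ⟨_, fun x => ?_, ?_, rfl⟩
  · have h1 := ha i
    have h2 := ha (i + 1)
    have h3 := ha x
    unfold ddExp
    split_ifs <;> omega
  · have := sum_ddExp hi hN a u v
    omega

lemma dd_mem_stair {N i d : ℕ} (hi : 1 ≤ i) (hN : i < N) {P : MvPolynomial ℕ ℚ}
    (hP : P ∈ stair N d) : dd i P ∈ stair N (d - 1) := by
  suffices stair N d ≤ (stair N (d - 1)).comap (ddL i) from this hP
  rw [stair, Submodule.span_le]
  rintro _ ⟨a, ha, hd, rfl⟩
  change dd i (mono N a) ∈ stair N (d - 1)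
  rcases le_total (a (i + 1)) (a i) with h | h
  · obtain ⟨c, hc⟩ := Nat.exists_eq_add_of_le h
    rw [dd_mono_of_ge hi hN a hc rfl]
    refine Submodule.sum_mem _ fun t ht => ?_
    rw [Finset.mem_range] at ht
    exact mono_ddExp_mem hi hN ha hd (by omega) (by omega) (by omega)
  · obtain ⟨c, hc⟩ := Nat.exists_eq_add_of_le h
    rw [dd_mono_of_le hi hN a rfl hc]
    refine Submodule.neg_mem _ (Submodule.sum_mem _ fun t ht => ?_)
    rw [Finset.mem_range] at ht
    exact mono_ddExp_mem hi hN ha hd (by omega) (by omega) (by omega)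

lemma sum_mul_sub (a : ℕ → ℚ) (N : ℕ) :
    ∑ i ∈ Finset.Ico 1 (N + 1), (i : ℚ) * (a i - a (i + 1)) =
      ∑ x ∈ Finset.Icc 1 (N + 1), a x - (N + 1) * a (N + 1) := by
  induction N with
  | zero => simp
  | succ N ih =>
    rw [Finset.sum_Ico_succ_top (by omega), ih,
      Finset.sum_Icc_succ_top (show 1 ≤ N + 1 + 1 by omega)]
    push_cast; ring

/-- Euler's identity for divided differences at the point `(1, 1, …)`. -/
lemma sum_mul_ev_dd {N d : ℕ} {P : MvPolynomial ℕ ℚ} (hP : P ∈ stair N d) :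
    ∑ i ∈ Finset.Ico 1 N, (i : ℚ) * ev (dd i P) = d * ev P := by
  let L : MvPolynomial ℕ ℚ →ₗ[ℚ] ℚ :=
    ∑ i ∈ Finset.Ico 1 N, (i : ℚ) • (ev.toLinearMap ∘ₗ ddL i) - (d : ℚ) • ev.toLinearMap
  have hL : ∀ Q, L Q = ∑ i ∈ Finset.Ico 1 N, (i : ℚ) * ev (dd i Q) - d * ev Q := by
    intro Q; simp [L, ddL_apply]
  suffices stair N d ≤ LinearMap.ker L by
    have := LinearMap.mem_ker.mp (this hP)
    rw [hL] at this; linarith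
  rw [stair, Submodule.span_le]
  rintro _ ⟨a, ha, hd, rfl⟩
  have hs : ∑ i ∈ Finset.Ico 1 N, (i : ℚ) * ev (dd i (mono N a)) =
      ∑ i ∈ Finset.Ico 1 N, (i : ℚ) * ((a i : ℚ) - a (i + 1)) :=
    Finset.sum_congr rfl fun i hi => by
      rw [Finset.mem_Ico] at hi; rw [ev_dd_mono hi.1 hi.2]
  rw [SetLike.mem_coe, LinearMap.mem_ker, hL, ev_mono, ← hd, hs]
  rcases N with _ | N
  · simp
  · have h0 : a (N + 1) = 0 := by have := ha (N + 1); omega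
    rw [sum_mul_sub (fun x => (a x : ℚ)) N, h0]
    simp

end Layered

namespace Layered

open MvPolynomial

lemma len_le (n : ℕ) (w : Equiv.Perm ℕ) : len n w ≤ n * n := by
  unfold len
  refine (Finset.card_filter_le _ _).trans ?_
  rw [Finset.card_product, Nat.card_Icc]; simp

/-- Schubert polynomials computed by descending from the longest permutation; `k` bounds the
number of divided differences. -/
noncomputable def schubAux (N : ℕ) : ℕ → Equiv.Perm ℕ → MvPolynomial ℕ ℚ
  | 0, _ => mono N (N - ·)
  | k + 1, w => open scoped Classical in
    if h : ∃ i, 1 ≤ i ∧ i < N ∧ w i < w (i + 1) then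
      dd h.choose (schubAux N k (w * sT h.choose))
    else mono N (N - ·)

/-- The Schubert polynomial of a permutation `w` of `1, …, N`. -/
noncomputable def schub (N : ℕ) (w : Equiv.Perm ℕ) : MvPolynomial ℕ ℚ :=
  schubAux N (N * N - len N w) w

lemma exists_schub_eq_dd {N : ℕ} {w : Equiv.Perm ℕ} (h : ∃ i, 1 ≤ i ∧ i < N ∧ w i < w (i + 1)) :
    ∃ i, 1 ≤ i ∧ i < N ∧ w i < w (i + 1) ∧ schub N w = dd i (schub N (w * sT i)) := by
  obtain ⟨h1, h2, h3⟩ := h.choose_spec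
  refine ⟨h.choose, h1, h2, h3, ?_⟩
  have hl := len_mul_sT_of_asc w h1 h2 h3
  have hb := len_le N (w * sT h.choose)
  rw [schub, show N * N - len N w = N * N - len N (w * sT h.choose) + 1 by omega, schubAux,
    dif_pos h, schub]

lemma schub_of_no_ascent {N : ℕ} {w : Equiv.Perm ℕ}
    (h : ¬ ∃ i, 1 ≤ i ∧ i < N ∧ w i < w (i + 1)) : schub N w = mono N (N - ·) := by
  rw [schub]
  cases N * N - len N w with
  | zero => rfl
  | succ k => rw [schubAux, dif_neg h]

lemma sT_comm {i j : ℕ} (h : i + 1 < j) : sT i * sT j = sT j * sT i := by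
  ext x
  simp only [Equiv.Perm.mul_apply, sT_apply]
  split_ifs <;> omega

lemma sT_braid (i : ℕ) : sT i * sT (i + 1) * sT i = sT (i + 1) * sT i * sT (i + 1) := by
  ext x
  simp only [Equiv.Perm.mul_apply, sT_apply]
  split_ifs <;> omega

lemma mul_sT_apply (w : Equiv.Perm ℕ) (i x : ℕ) :
    (w * sT i) x = w (if x = i then i + 1 else if x = i + 1 then i else x) := by
  rw [Equiv.Perm.mul_apply, sT_apply]

private lemma schub_diamond {N : ℕ} {w : Equiv.Perm ℕ}
    (ih : ∀ u : Equiv.Perm ℕ, len N w < len N u → ∀ i, 1 ≤ i → i < N → u i < u (i + 1) →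
      schub N u = dd i (schub N (u * sT i)))
    {i j : ℕ} (hi : 1 ≤ i) (hij : i < j) (hj : j < N) (hwi : w i < w (i + 1))
    (hwj : w j < w (j + 1)) :
    dd i (schub N (w * sT i)) = dd j (schub N (w * sT j)) := by
  have li := len_mul_sT_of_asc (n := N) w hi (by omega) hwi
  have lj := len_mul_sT_of_asc w (by omega) hj hwj
  rcases Nat.lt_or_ge (i + 1) j with h | h
  · have a1 : (w * sT i) j < (w * sT i) (j + 1) := by
      rw [mul_sT_apply_of_ne w (by omega) (by omega), mul_sT_apply_of_ne w (by omega) (by omega)]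
      exact hwj
    have a2 : (w * sT j) i < (w * sT j) (i + 1) := by
      rw [mul_sT_apply_of_ne w (by omega) (by omega), mul_sT_apply_of_ne w (by omega) (by omega)]
      exact hwi
    rw [ih _ (by omega) j (by omega) hj a1, ih _ (by omega) i hi (by omega) a2, mul_assoc,
      mul_assoc, sT_comm h, dd_comm h]
  · obtain rfl : j = i + 1 := by omega
    have e1 : (i + 1 + 1 = i) = False := eq_false (by omega)
    have e2 : (i = i + 1 + 1) = False := eq_false (by omega)
    have e3 : (i + 1 = i) = False := eq_false (by omega)
    have e4 : (i + 1 + 1 = i + 1) = False := eq_false (by omega)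
    have e5 : (i = i + 1) = False := eq_false (by omega)
    have a1 : (w * sT i) (i + 1) < (w * sT i) (i + 1 + 1) := by
      simp only [mul_sT_apply, e1, e3, e4, if_true, if_false]; omega
    have a2 : (w * sT (i + 1)) i < (w * sT (i + 1)) (i + 1) := by
      simp only [mul_sT_apply, e2, if_true, if_false, e5]; omega
    have a3 : (w * sT i * sT (i + 1)) i < (w * sT i * sT (i + 1)) (i + 1) := by
      simp only [mul_sT_apply, e1, e2, e4, if_true, if_false, e5]; omega
    have a4 : (w * sT (i + 1) * sT i) (i + 1) < (w * sT (i + 1) * sT i) (i + 1 + 1) := by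
      simp only [mul_sT_apply, e1, e2, e3, e4, if_true, if_false, e5]; omega
    have l1 := len_mul_sT_of_asc _ (show 1 ≤ i + 1 by omega) hj a1
    have l2 := len_mul_sT_of_asc _ hi (show i < N by omega) a2
    rw [ih _ (by omega) (i + 1) (by omega) hj a1, ih _ (by omega) i hi (by omega) a2,
      ih _ (by omega) i hi (by omega) a3, ih _ (by omega) (i + 1) (by omega) hj a4, dd_braid]
    congr 4
    simpa only [mul_assoc] using congrArg (w * ·) (sT_braid i)

lemma schub_eq_dd {N : ℕ} {w : Equiv.Perm ℕ} {i : ℕ} (hi : 1 ≤ i) (hN : i < N)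
    (h : w i < w (i + 1)) : schub N w = dd i (schub N (w * sT i)) := by
  induction hk : N * N - len N w using Nat.strong_induction_on generalizing w i with
  | _ k ihk =>
  have ih : ∀ u : Equiv.Perm ℕ, len N w < len N u → ∀ i, 1 ≤ i → i < N → u i < u (i + 1) →
      schub N u = dd i (schub N (u * sT i)) := fun u hu i h1 h2 h3 =>
    ihk (N * N - len N u) (by have := len_le N u; omega) h1 h2 h3 rfl
  obtain ⟨j, hj, hjN, hwj, e⟩ := exists_schub_eq_dd ⟨i, hi, hN, h⟩
  rw [e]
  rcases lt_trichotomy i j with hij | rfl | hij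
  · exact (schub_diamond ih hi hij hjN h hwj).symm
  · rfl
  · exact schub_diamond ih hj hij hN hwj h

lemma dd_schub_of_desc {N : ℕ} {w : Equiv.Perm ℕ} {i : ℕ} (hi : 1 ≤ i) (hN : i < N)
    (h : w (i + 1) < w i) : dd i (schub N w) = schub N (w * sT i) := by
  rw [schub_eq_dd (w := w * sT i) hi hN, mul_sT_mul_sT]
  rwa [mul_sT_apply_left, mul_sT_apply_right]

lemma dd_schub_of_asc {N : ℕ} {w : Equiv.Perm ℕ} {i : ℕ} (hi : 1 ≤ i) (hN : i < N)
    (h : w i < w (i + 1)) : dd i (schub N w) = 0 := by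
  rw [schub_eq_dd hi hN h, dd_dd]

lemma dd_schub {N : ℕ} {w : Equiv.Perm ℕ} {i : ℕ} (hi : 1 ≤ i) (hN : i < N) :
    dd i (schub N w) = 0 ∨ dd i (schub N w) = schub N (w * sT i) :=
  (asc_or_desc w i).imp (dd_schub_of_asc hi hN) (dd_schub_of_desc hi hN)

lemma len_of_no_ascent {N : ℕ} {w : Equiv.Perm ℕ}
    (h : ¬ ∃ i, 1 ≤ i ∧ i < N ∧ w i < w (i + 1)) : len N w = ∑ x ∈ Finset.Icc 1 N, (N - x) := by
  have hd : ∀ x y, 1 ≤ x → x < y → y ≤ N → w y < w x := by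
    intro x y hx hxy
    induction y, hxy using Nat.le_induction with
    | base =>
      intro hy
      exact (asc_or_desc w x).resolve_left fun hc => h ⟨x, hx, by omega, hc⟩
    | succ y hxy ih =>
      intro hy
      exact ((asc_or_desc w y).resolve_left fun hc => h ⟨y, by omega, by omega, hc⟩).trans
        (ih (by omega))
  unfold len
  rw [Finset.card_filter, Finset.sum_product]
  refine Finset.sum_congr rfl fun x hx => ?_
  rw [Finset.mem_Icc] at hx
  rw [← Finset.card_filter]
  have : (Finset.Icc 1 N).filter (fun y => x < y ∧ w y < w x) = Finset.Ioc x N := by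
    ext y
    simp only [Finset.mem_filter, Finset.mem_Icc, Finset.mem_Ioc]
    exact ⟨fun h => ⟨h.2.1, h.1.2⟩, fun h => ⟨⟨by omega, h.2⟩, h.1, hd x y hx.1 h.1 h.2⟩⟩
  rw [this, Nat.card_Ioc]

lemma schub_mem_stair (N : ℕ) (w : Equiv.Perm ℕ) : schub N w ∈ stair N (len N w) := by
  induction hk : N * N - len N w using Nat.strong_induction_on generalizing w with
  | _ k ih =>
  by_cases h : ∃ i, 1 ≤ i ∧ i < N ∧ w i < w (i + 1)
  · obtain ⟨i, hi, hN, hw⟩ := h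
    have l := len_mul_sT_of_asc w hi hN hw
    have := len_le N (w * sT i)
    rw [schub_eq_dd hi hN hw]
    have := dd_mem_stair hi hN (ih _ (by omega) (w * sT i) rfl)
    rwa [l, Nat.add_sub_cancel] at this
  · rw [schub_of_no_ascent h, len_of_no_ascent h]
    exact Submodule.subset_span ⟨_, fun x => le_rfl, rfl, rfl⟩

lemma blockRev_apply (s c x : ℕ) :
    blockRev s c x = if s < x ∧ x ≤ s + c then 2 * s + c + 1 - x else x := by
  have key : ∀ k, k ≤ c / 2 →
      ((List.range k).map fun i => Equiv.swap (s + i + 1) (s + c - i)).prod x =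
        if (s < x ∧ x ≤ s + k) ∨ (s + c < x + k ∧ x ≤ s + c) then 2 * s + c + 1 - x else x := by
    intro k hk
    induction k generalizing x with
    | zero => rw [if_neg (by omega)]; simp
    | succ k ih =>
      rw [List.range_succ, List.map_append, List.prod_append, Equiv.Perm.mul_apply, ih _ (by omega)]
      simp only [List.map_cons, List.map_nil, List.prod_singleton, Equiv.swap_apply_def]
      split_ifs <;> omega
  rw [blockRev, key _ le_rfl]
  split_ifs <;> omega

lemma supp_blockRev (s c : ℕ) : Supp s (s + c) (blockRev s c) := fun x hx => by
  rw [blockRev_apply, if_neg (by omega)]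

lemma schub_blockRev_zero (N : ℕ) : schub N (blockRev 0 N) = mono N (N - ·) := by
  apply schub_of_no_ascent
  rintro ⟨i, h1, h2, h3⟩
  rw [blockRev_apply, blockRev_apply] at h3
  split_ifs at h3 <;> omega

/-- The composition `dd (i + m - 1) ∘ ⋯ ∘ dd (i + 1) ∘ dd i`. -/
noncomputable def ddc (i : ℕ) : ℕ → MvPolynomial ℕ ℚ → MvPolynomial ℕ ℚ
  | 0, P => P
  | m + 1, P => dd (i + m) (ddc i m P)

/-- The cycle `i ↦ i + 1 ↦ ⋯ ↦ i + m ↦ i`. -/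
def cyc (i m : ℕ) : Equiv.Perm ℕ := ((List.range m).map fun j => sT (i + j)).prod

lemma cyc_succ (i m : ℕ) : cyc i (m + 1) = cyc i m * sT (i + m) := by
  simp [cyc, List.range_succ]

lemma cyc_apply (i m x : ℕ) :
    cyc i m x = if i ≤ x ∧ x < i + m then x + 1 else if x = i + m then i else x := by
  induction m generalizing x with
  | zero => rw [if_neg (by omega)]; simp [cyc]
  | succ m ih =>
    rw [cyc_succ, mul_sT_apply, ih]
    split_ifs <;> omega

lemma ddc_schub {N : ℕ} (w : Equiv.Perm ℕ) {i m : ℕ} (hi : 1 ≤ i) (hN : i + m ≤ N) :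
    ddc i m (schub N w) = 0 ∨ ddc i m (schub N w) = schub N (w * cyc i m) := by
  induction m with
  | zero => right; simp [ddc, cyc]
  | succ m ih =>
    rw [ddc, cyc_succ, ← mul_assoc]
    rcases ih (by omega) with h | h
    · left; rw [h, dd_zero]
    · rw [h]; exact dd_schub (by omega) (by omega)

lemma schub_mul_cyc {N : ℕ} {w : Equiv.Perm ℕ} {i m : ℕ} {P : MvPolynomial ℕ ℚ} (hi : 1 ≤ i)
    (hN : i + m ≤ N) (h : schub N w = P) (h0 : ddc i m P ≠ 0) :
    schub N (w * cyc i m) = ddc i m P := by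
  subst h
  exact ((ddc_schub w hi hN).resolve_left h0).symm

end Layered

namespace Layered

open MvPolynomial

lemma mono_ne_zero (N : ℕ) (a : ℕ → ℕ) : mono N a ≠ 0 := fun h => by
  have := ev_mono N a
  rw [h, map_zero] at this
  exact zero_ne_one this

lemma ddc_mono_stair {m p k : ℕ} (hp : 1 ≤ p) (j : ℕ) (hj : j + k ≤ m) :
    ddc p j (mono (m + p) (fun x => if x < p then m + p - x else m + p - k - x)) =
      mono (m + p) (fun x => if x < p then m + p - x else
        if x < p + j then m + p - k - x - 1 else m + p - k - x) := by
  induction j with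
  | zero =>
    rw [ddc]; congr 1; funext x
    split_ifs <;> first | rfl | omega
  | succ j ih =>
    rw [ddc, ih (by omega)]
    apply dd_mono_of_eq_add_one (by omega) (by omega)
    · rw [if_neg (by omega), if_neg (by omega), if_neg (by omega), if_neg (by omega)]; omega
    · intro x
      split_ifs <;> omega

/-- Sorting the values in positions `p, …, m + p` of the longest permutation. -/
lemma exists_schub_tail {m p : ℕ} (hp : 1 ≤ p) (k : ℕ) (hk : k ≤ m) :
    ∃ w : Equiv.Perm ℕ, (∀ x, w x = if x < 1 ∨ m + p < x then x else
        if x < p then m + p + 1 - x else if x + k ≤ m + p then m + p + 1 - x - k else x - p + 1) ∧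
      schub (m + p) w =
        mono (m + p) (fun x => if x < p then m + p - x else m + p - k - x) := by
  induction k with
  | zero =>
    refine ⟨blockRev 0 (m + p), fun x => ?_, ?_⟩
    · rw [blockRev_apply]
      split_ifs <;> omega
    · rw [schub_blockRev_zero]
      congr 1; funext x
      split_ifs <;> rfl
  | succ k ih =>
    obtain ⟨w, hw, hs⟩ := ih (by omega)
    have e := ddc_mono_stair (m := m) (k := k) hp (m - k) (by omega)
    refine ⟨w * cyc p (m - k), fun x => ?_, ?_⟩
    · rw [Equiv.Perm.mul_apply, cyc_apply, hw]
      split_ifs <;> omega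
    · rw [schub_mul_cyc hp (by omega) hs (by rw [e]; exact mono_ne_zero _ _), e]
      congr 1; funext x
      split_ifs <;> omega

lemma schub_one (N : ℕ) : schub N 1 = 1 := by
  rcases N with _ | N
  · rw [schub_of_no_ascent (by rintro ⟨i, h1, h2, -⟩; omega)]; simp [mono]
  · obtain ⟨w, hw, hs⟩ := exists_schub_tail (m := N) (p := 1) le_rfl N le_rfl
    have : w = 1 := by
      ext x
      rw [hw, Equiv.Perm.one_apply]
      split_ifs <;> omega
    rw [← this, hs]
    refine Finset.prod_eq_one fun x hx => ?_
    rw [Finset.mem_Icc] at hx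
    beta_reduce
    rw [if_neg (by omega), show N + 1 - N - x = 0 by omega, pow_zero]

/-- Macdonald's identity. -/
lemma upsilon_eq_ev_schub {N : ℕ} {w : Equiv.Perm ℕ} (hw : Supp 0 N w) :
    Upsilon N w = ev (schub N w) := by
  induction hk : len N w using Nat.strong_induction_on generalizing w with
  | _ k ih =>
  by_cases h0 : len N w = 0
  · rw [hw.eq_one_of_len h0, upsilon_one, schub_one, map_one]
  have h0' : (len N w : ℚ) ≠ 0 := by exact_mod_cast h0
  apply mul_left_cancel₀ h0'
  rw [len_mul_upsilon N w h0, ← sum_mul_ev_dd (schub_mem_stair N w), Finset.sum_filter]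
  refine Finset.sum_congr rfl fun i hi => ?_
  rw [Finset.mem_Ico] at hi
  split_ifs with h
  · have := len_mul_sT_of_desc w hi.1 hi.2 h
    rw [dd_schub_of_desc hi.1 hi.2 h,
      ih (len N (w * sT i)) (by omega) (hw.mul_sT (by omega) hi.2) rfl]
  · rw [dd_schub_of_asc hi.1 hi.2 ((asc_or_desc w i).resolve_right h), map_zero, mul_zero]

/-- Complete homogeneous polynomials in `X 1, …, X k`. -/
noncomputable def chomNat : ℕ → ℕ → MvPolynomial ℕ ℚ
  | _, 0 => 1
  | 0, _ + 1 => 0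
  | k + 1, r + 1 => chomNat k (r + 1) + X (k + 1) * chomNat (k + 1) r

/-- Complete homogeneous polynomials in `X 1, …, X k`, vanishing in negative degrees. -/
noncomputable def chom (k : ℕ) (r : ℤ) : MvPolynomial ℕ ℚ := if r < 0 then 0 else chomNat k r.toNat

lemma chom_of_neg (k : ℕ) {r : ℤ} (h : r < 0) : chom k r = 0 := if_pos h

lemma chom_natCast (k r : ℕ) : chom k (r : ℤ) = chomNat k r := by
  rw [chom, if_neg (by omega), Int.toNat_natCast]

lemma chom_deg_zero (k : ℕ) : chom k 0 = 1 := by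
  have := chom_natCast k 0
  rw [Nat.cast_zero] at this
  rw [this]; cases k <;> rw [chomNat]

lemma chom_zero (r : ℤ) : chom 0 r = if r = 0 then 1 else 0 := by
  split_ifs with h
  · rw [h, chom_deg_zero]
  rcases lt_or_ge r 0 with h' | h'
  · exact chom_of_neg 0 h'
  · lift r to ℕ using h'
    obtain ⟨s, rfl⟩ := Nat.exists_eq_succ_of_ne_zero (show r ≠ 0 by omega)
    rw [chom_natCast, chomNat]

lemma chom_succ (k : ℕ) (r : ℤ) :
    chom (k + 1) r = chom k r + X (k + 1) * chom (k + 1) (r - 1) := by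
  rcases lt_trichotomy r 0 with h | rfl | h
  · rw [chom_of_neg _ h, chom_of_neg _ h, chom_of_neg _ (by omega)]; ring
  · rw [chom_deg_zero, chom_deg_zero, chom_of_neg _ (by omega)]; ring
  · obtain ⟨s, rfl⟩ : ∃ s : ℕ, r = (s + 1 : ℕ) := ⟨(r - 1).toNat, by omega⟩
    rw [show ((s + 1 : ℕ) : ℤ) - 1 = (s : ℕ) by push_cast; ring, chom_natCast, chom_natCast,
      chom_natCast, chomNat]

/-- To prove a property of all integers holding for the negative ones it suffices to do one
step up. -/
lemma int_induction_of_neg {p : ℤ → Prop} (h0 : ∀ r < 0, p r) (h1 : ∀ r, p (r - 1) → p r)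
    (r : ℤ) : p r := by
  rcases lt_or_ge r 0 with h | h
  · exact h0 r h
  · lift r to ℕ using h
    induction r with
    | zero => exact h1 _ (h0 _ (by simp))
    | succ r ih => exact h1 _ (by push_cast; simpa using ih)

lemma sw_dd (i : ℕ) (P : MvPolynomial ℕ ℚ) : sw i (dd i P) = dd i P := by
  have := dd_spec i (dd i P)
  rw [dd_dd, mul_zero] at this
  exact (sub_eq_zero.mp this.symm).symm

lemma sw_chom_of_lt {i k : ℕ} (h : k < i) (r : ℤ) : sw i (chom k r) = chom k r := by
  induction k generalizing r with
  | zero => rw [chom_zero]; split_ifs <;> simp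
  | succ k ih =>
    induction r using int_induction_of_neg with
    | h0 r hr => rw [chom_of_neg _ hr, map_zero]
    | h1 r ihr =>
      rw [chom_succ, map_add, map_mul, ih (by omega), ihr, sw_X_of_ne (by omega) (by omega)]

lemma dd_chom {i : ℕ} (hi : 1 ≤ i) (r : ℤ) : dd i (chom i r) = chom (i + 1) (r - 1) := by
  obtain ⟨k, rfl⟩ : ∃ k, i = k + 1 := ⟨i - 1, by omega⟩
  apply dd_eq
  induction r using int_induction_of_neg with
  | h0 r hr => rw [chom_of_neg _ hr, chom_of_neg _ (by omega)]; simp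
  | h1 r ih =>
    rw [chom_succ (k + 1) (r - 1), chom_succ k r, map_add, map_mul, sw_X_left,
      sw_chom_of_lt (by omega)]
    linear_combination X (k + 1 + 1) * ih

lemma sw_chom {i k : ℕ} (hi : 1 ≤ i) (h : i ≠ k) (r : ℤ) : sw i (chom k r) = chom k r := by
  rcases Nat.lt_or_gt_of_ne h with h | h
  · induction k, h using Nat.le_induction generalizing r with
    | base =>
      have := sw_dd i (chom i (r + 1))
      rwa [dd_chom hi, add_sub_cancel_right] at this
    | succ k hk ih =>
      induction r using int_induction_of_neg with
      | h0 r hr => rw [chom_of_neg _ hr, map_zero]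
      | h1 r ihr =>
        rw [chom_succ, map_add, map_mul, ih (by omega), ihr, sw_X_of_ne (by omega) (by omega)]
  · exact sw_chom_of_lt h r

lemma ev_chom (k r : ℕ) : ev (chom (k + 1) r) = (r + k).choose k := by
  have hX : ∀ x, ev (X x) = 1 := fun x => by simp [ev]
  induction k generalizing r with
  | zero =>
    induction r with
    | zero => simp [chom_deg_zero]
    | succ r ih =>
      rw [chom_succ, map_add, map_mul, hX, chom_zero, if_neg (by omega)]
      push_cast
      simp [ih]
  | succ k ih =>
    induction r with
    | zero => simp [chom_deg_zero]
    | succ r ihr =>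
      rw [chom_succ, map_add, map_mul, hX, ih]
      push_cast
      rw [add_sub_cancel_right, ihr, show r + 1 + (k + 1) = (r + 1 + k) + 1 by ring,
        Nat.choose_succ_succ, show r + (k + 1) = r + 1 + k by ring]
      push_cast; ring

end Layered

namespace Layered

open MvPolynomial Matrix

/-- A divided difference acts on a determinant through a single row if the other rows are
invariant. -/
lemma dd_det {n : ℕ} {k : ℕ} {M M' : Matrix (Fin n) (Fin n) (MvPolynomial ℕ ℚ)} (i₀ : Fin n)
    (h : ∀ i ≠ i₀, ∀ j, sw k (M i j) = M i j) (h' : ∀ i ≠ i₀, ∀ j, M' i j = M i j)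
    (h₀ : ∀ j, M' i₀ j = dd k (M i₀ j)) : dd k M.det = M'.det := by
  rw [← det_transpose M, ← det_transpose M', det_apply', det_apply', dd_sum]
  refine Finset.sum_congr rfl fun σ _ => ?_
  rw [← Finset.prod_erase_mul _ _ (Finset.mem_univ i₀),
    ← Finset.prod_erase_mul _ _ (Finset.mem_univ i₀), ← mul_assoc, ← mul_assoc, dd_mul_of_sw_eq]
  · simp only [transpose_apply, h₀]
    congr 2
    exact Finset.prod_congr rfl fun i hi => (h' i (Finset.ne_of_mem_erase hi) _).symm
  · rw [map_mul, map_intCast, map_prod]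
    congr 1
    exact Finset.prod_congr rfl fun i hi => h i (Finset.ne_of_mem_erase hi) _

/-- The matrix whose determinant interpolates between a monomial (`r = n + 1`) and the Schubert
polynomial of a block reversal (`r = 1`). -/
noncomputable def chomMat (m n r : ℕ) : Matrix (Fin n) (Fin n) (MvPolynomial ℕ ℚ) := fun i j =>
  if (i : ℕ) + 1 < r then chom (i + 1) (m + n - 2 * (i : ℕ) + (j : ℕ))
  else chom (m + i + 1) (n - 2 * (i : ℕ) + (j : ℕ))

lemma ddc_det_chomMat (m n r : ℕ) (hr : 1 ≤ r) (hn : r ≤ n) :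
    ddc r m (chomMat m n (r + 1)).det = (chomMat m n r).det := by
  let i₀ : Fin n := ⟨r - 1, by omega⟩
  have key : ∀ t ≤ m, ddc r t (chomMat m n (r + 1)).det = Matrix.det (fun i j : Fin n =>
      if i = i₀ then chom (r + t) (m + n - 2 * (i : ℕ) + (j : ℕ) - t)
      else chomMat m n (r + 1) i j) := by
    intro t ht
    induction t with
    | zero =>
      rw [ddc]
      congr 1
      funext i j
      split_ifs with h
      · subst h
        rw [chomMat, if_pos (by simp only [i₀]; omega)]
        simp only [i₀, Nat.sub_add_cancel hr]
        congr 1; simp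
      · rfl
    | succ t ih =>
      rw [ddc, ih (by omega)]
      refine dd_det i₀ (fun i hi j => ?_) (fun i hi j => ?_) (fun j => ?_)
      · have hi' : (i : ℕ) ≠ r - 1 := fun e => hi (Fin.ext e)
        rw [if_neg hi, chomMat]
        split_ifs <;> exact sw_chom (by omega) (by omega) _
      · rw [if_neg hi, if_neg hi]
      · rw [if_pos rfl, if_pos rfl, dd_chom (by omega)]
        congr 1; push_cast; ring
  rw [key m le_rfl]
  congr 1
  funext i j
  split_ifs with h
  · subst h
    rw [chomMat, if_neg (by simp only [i₀]; omega)]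
    congr 1
    · simp only [i₀]; omega
    · ring
  · have hi' : (i : ℕ) ≠ r - 1 := fun e => h (Fin.ext e)
    rw [chomMat, chomMat]
    split_ifs <;> first | rfl | omega

/-- Complete homogeneous polynomials in `X (s + 1), …, X k` when `s ≤ k`. -/
noncomputable def chomFrom (k : ℕ) : ℕ → ℤ → MvPolynomial ℕ ℚ
  | 0, r => chom k r
  | s + 1, r => chomFrom k s r - X (s + 1) * chomFrom k s (r - 1)

lemma chomFrom_of_neg (k s : ℕ) {r : ℤ} (h : r < 0) : chomFrom k s r = 0 := by
  induction s generalizing r with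
  | zero => rw [chomFrom, chom_of_neg _ h]
  | succ s ih => rw [chomFrom, ih h, ih (by omega)]; ring

lemma chomFrom_succ (k s : ℕ) (r : ℤ) :
    chomFrom (k + 1) s r = chomFrom k s r + X (k + 1) * chomFrom (k + 1) s (r - 1) := by
  induction s generalizing r with
  | zero => simp only [chomFrom]; exact chom_succ k r
  | succ s ih =>
    simp only [chomFrom]
    linear_combination ih r - X (s + 1) * ih (r - 1)

lemma chomFrom_self (k : ℕ) (r : ℤ) : chomFrom k k r = if r = 0 then 1 else 0 := by
  induction k generalizing r with
  | zero => rw [chomFrom, chom_zero]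
  | succ k ih => rw [chomFrom, ← ih]; linear_combination chomFrom_succ k k r

lemma chomFrom_succ_self (k r : ℕ) : chomFrom (k + 1) k r = X (k + 1) ^ r := by
  induction r with
  | zero => rw [chomFrom_succ, chomFrom_self, chomFrom_of_neg _ _ (by simp)]; simp
  | succ r ih =>
    rw [chomFrom_succ, chomFrom_self, if_neg (by omega)]
    push_cast
    rw [add_sub_cancel_right, ih]; ring

lemma chomFrom_of_lt (k t : ℕ) {r : ℤ} (h : (t : ℤ) < r) : chomFrom k (k + t) r = 0 := by
  induction t generalizing r with
  | zero => rw [add_zero, chomFrom_self, if_neg (by omega)]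
  | succ t ih => rw [← add_assoc, chomFrom, ih (by omega), ih (by omega)]; ring

lemma chom_eq_sum (k j : ℕ) (r : ℤ) :
    chom k (r + j) = ∑ s ∈ Finset.range (j + 1), chomFrom k s (r + s) * chom (s + 1) (j - s) := by
  induction j generalizing r with
  | zero => simp [chom_deg_zero, chomFrom]
  | succ j ih =>
    have h1 : ∀ s ∈ Finset.range (j + 2), chomFrom k s (r + s) * chom (s + 1) ((j + 1 : ℕ) - s) =
        chomFrom k s (r + s) * chom s ((j + 1 : ℕ) - s) +
          X (s + 1) * chomFrom k s (r + s) * chom (s + 1) (j - s) := by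
      intro s _
      rw [chom_succ, show ((j + 1 : ℕ) : ℤ) - s - 1 = j - s by push_cast; ring]; ring
    rw [Finset.sum_congr rfl h1, Finset.sum_add_distrib, Finset.sum_range_succ',
      Finset.sum_range_succ (fun s => X (s + 1) * chomFrom k s (r + s) * chom (s + 1) (j - s)),
      chom_zero, if_neg (by push_cast; omega), chom_of_neg (j + 1 + 1) (by push_cast; omega),
      mul_zero, mul_zero, add_zero, add_zero, ← Finset.sum_add_distrib]
    rw [show r + ((j + 1 : ℕ) : ℤ) = (r + 1) + j by push_cast; ring, ih]
    refine Finset.sum_congr rfl fun s _ => ?_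
    have : chomFrom k (s + 1) (r + (s + 1 : ℕ)) =
        chomFrom k s (r + 1 + s) - X (s + 1) * chomFrom k s (r + s) := by
      rw [chomFrom]; congr 2 <;> [skip; congr 1] <;> push_cast <;> ring
    rw [this, show ((j + 1 : ℕ) : ℤ) - (s + 1 : ℕ) = j - s by push_cast; ring]
    ring

lemma det_chomMat_top (m n : ℕ) :
    (chomMat m n (n + 1)).det = ∏ i : Fin n, X ((i : ℕ) + 1) ^ (m + n - (i : ℕ)) := by
  let L : Matrix (Fin n) (Fin n) (MvPolynomial ℕ ℚ) := fun i s =>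
    chomFrom (i + 1) s (m + n - 2 * (i : ℕ) + (s : ℕ))
  let U : Matrix (Fin n) (Fin n) (MvPolynomial ℕ ℚ) := fun s j =>
    chom (s + 1) ((j : ℕ) - (s : ℕ))
  have hM : chomMat m n (n + 1) = L * U := by
    funext i j
    rw [chomMat, if_pos (by omega), chom_eq_sum, mul_apply]
    have : ∑ s : Fin n, L i s * U s j = ∑ s ∈ Finset.range n,
        (chomFrom (i + 1) s (m + n - 2 * (i : ℕ) + s) * chom (s + 1) ((j : ℕ) - s) :
          MvPolynomial ℕ ℚ) :=
      Fin.sum_univ_eq_sum_range (fun s => chomFrom (i + 1) s (m + n - 2 * (i : ℕ) + s) *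
        chom (s + 1) ((j : ℕ) - s)) n
    rw [this]
    have hj : Finset.range ((j : ℕ) + 1) ⊆ Finset.range n := Finset.range_mono (by omega)
    refine Finset.sum_subset hj fun s _ hs => ?_
    rw [Finset.mem_range] at hs
    rw [chom_of_neg _ (by omega), mul_zero]
  have hU : U.det = 1 := by
    rw [det_of_isUpperTriangular]
    · exact Finset.prod_eq_one fun i _ => by simp only [U, sub_self, chom_deg_zero]
    · intro i j hij
      have : (j : ℕ) < i := hij
      exact chom_of_neg _ (by omega)
  rw [hM, det_mul, hU, mul_one, det_of_isLowerTriangular]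
  · refine Finset.prod_congr rfl fun i _ => ?_
    rw [← chomFrom_succ_self]
    simp only [L]
    congr 1; omega
  · intro i j hij
    have hij' : (i : ℕ) < j := hij
    obtain ⟨t, ht⟩ := Nat.exists_eq_add_of_lt hij'
    simp only [L]
    rw [show (j : ℕ) = i + 1 + t by omega]
    exact chomFrom_of_lt _ _ (by push_cast; omega)

/-- The determinantal formula for the Schubert polynomial of a block reversal at `X = 1`. -/
noncomputable def binomMat (m n : ℕ) : Matrix (Fin n) (Fin n) ℚ := fun i j =>
  ((n + m - (i : ℕ) + j).choose (m + i) : ℕ)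

lemma ev_det_chomMat (m n : ℕ) : ev (chomMat m n 1).det = (binomMat m n).det := by
  have h : ev (chomMat m n 1).det = ((ev : MvPolynomial ℕ ℚ →ₐ[ℚ] ℚ).toRingHom.mapMatrix
    (chomMat m n 1)).det := RingHom.map_det _ _
  rw [h]
  congr 1
  ext i j
  change ev (chomMat m n 1 i j) = _
  rw [chomMat, if_neg (by omega), binomMat]
  rcases lt_or_ge ((n : ℤ) - 2 * (i : ℕ) + (j : ℕ)) 0 with h | h
  · rw [chom_of_neg _ h, map_zero, Nat.choose_eq_zero_of_lt (by omega), Nat.cast_zero]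
  · rw [show (n : ℤ) - 2 * (i : ℕ) + (j : ℕ) = (n + j - 2 * i : ℕ) by omega, ev_chom,
      show n + j - 2 * (i : ℕ) + (m + i) = n + m - i + j by omega]

/-- The specialization of the Schubert polynomial of a block reversal as a determinant. -/
lemma upsilon_blockRev_eq_det (m n : ℕ) (h0 : (binomMat m n).det ≠ 0) :
    Upsilon (m + (n + 1)) (blockRev m (n + 1)) = (binomMat m n).det := by
  have hne : ∀ r, 1 ≤ r → r ≤ n + 1 → (chomMat m n r).det ≠ 0 := by
    intro r hr
    induction r, hr using Nat.le_induction with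
    | base =>
      intro _ h
      rw [← ev_det_chomMat, h, map_zero] at h0
      exact h0 rfl
    | succ r hr ih =>
      intro hn h
      refine ih (by omega) ?_
      rw [← ddc_det_chomMat m n r hr (by omega), h]
      have : ∀ t, ddc r t 0 = 0 := fun t => by
        induction t with
        | zero => rfl
        | succ t ih => rw [ddc, ih, dd_zero]
      exact this m
  have key : ∀ k ≤ n, ∃ w : Equiv.Perm ℕ, (∀ x, w x = if x < 1 ∨ m + (n + 1) < x then x else
      if x + k < n + 1 then m + (n + 1) + 1 - x else
      if x + k < n + 1 + m then x + k - n else m + (n + 1) + m + 1 - x) ∧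
      schub (m + (n + 1)) w = (chomMat m n (n + 1 - k)).det := by
    intro k hk
    induction k with
    | zero =>
      obtain ⟨w, hw, hs⟩ := exists_schub_tail (m := m) (p := n + 1) (by omega) m le_rfl
      refine ⟨w, fun x => ?_, ?_⟩
      · rw [hw]; split_ifs <;> omega
      · have e : ∏ x ∈ Finset.Ico 1 (n + 1), (X x : MvPolynomial ℕ ℚ) ^ (m + (n + 1) - x) =
            ∏ i ∈ Finset.range n, X (i + 1) ^ (m + n - i) := by
          rw [Finset.prod_Ico_eq_prod_range]
          refine Finset.prod_congr rfl fun i _ => ?_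
          rw [add_comm 1 i, show m + (n + 1) - (i + 1) = m + n - i by omega]
        rw [hs, Nat.sub_zero, det_chomMat_top, mono, Fin.prod_univ_eq_prod_range
          (fun i => (X (i + 1) : MvPolynomial ℕ ℚ) ^ (m + n - i)) n, ← e]
        symm
        refine Finset.prod_subset_one_on_sdiff (fun x hx => ?_) (fun x hx => ?_) (fun x hx => ?_)
        · simp only [Finset.mem_Ico, Finset.mem_Icc] at *; omega
        · simp only [Finset.mem_sdiff, Finset.mem_Ico, Finset.mem_Icc] at hx
          rw [if_neg (by omega), show m + (n + 1) - m - x = 0 by omega, pow_zero]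
        · rw [Finset.mem_Ico] at hx
          rw [if_pos (by omega)]
    | succ k ih =>
      obtain ⟨w, hw, hs⟩ := ih (by omega)
      have e := ddc_det_chomMat m n (n - k) (by omega) (by omega)
      rw [show n - k + 1 = n + 1 - k by omega] at e
      refine ⟨w * cyc (n - k) m, fun x => ?_, ?_⟩
      · rw [Equiv.Perm.mul_apply, cyc_apply, hw]
        split_ifs <;> omega
      · rw [schub_mul_cyc (by omega) (by omega) hs, e, show n + 1 - (k + 1) = n - k by omega]
        rw [e]; exact hne _ (by omega) (by omega)
  obtain ⟨w, hw, hs⟩ := key n le_rfl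
  have : w = blockRev m (n + 1) := by
    ext x
    rw [hw, blockRev_apply]
    split_ifs <;> omega
  rw [← this, upsilon_eq_ev_schub, hs, show n + 1 - n = 1 by omega, ev_det_chomMat]
  intro x hx
  rw [hw, if_pos (by omega)]

end Layered

namespace Layered

open Polynomial Matrix

/-- Determinants of evaluations of polynomials of small degree at different points are
proportional to the Vandermonde determinants. -/
lemma det_eval_mul_det_vandermonde {n : ℕ} (p : Fin n → ℚ[X]) (hp : ∀ j, (p j).natDegree < n)
    (x y : Fin n → ℚ) :
    Matrix.det (.of fun i j => (p j).eval (x i)) * (vandermonde y).det =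
      Matrix.det (.of fun i j => (p j).eval (y i)) * (vandermonde x).det := by
  let K : Matrix (Fin n) (Fin n) ℚ := fun k j => (p j).coeff k
  have h : ∀ z : Fin n → ℚ, (.of fun i j => (p j).eval (z i)) = vandermonde z * K := by
    intro z
    ext i j
    rw [mul_apply, of_apply, eval_eq_sum_range' (hp j), ← Fin.sum_univ_eq_sum_range
      (fun k => (p j).coeff k * z i ^ k)]
    exact Finset.sum_congr rfl fun k _ => by rw [vandermonde_apply, mul_comm]
  rw [h, h, det_mul, det_mul]; ring

/-- Up to factors depending on the row only, the entries of `binomMat m n` are the values of these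
polynomials at `0, -1, -2, …`. -/
noncomputable def colPoly (m n j : ℕ) : ℚ[X] :=
  (∏ k ∈ Finset.range j, (X + C (n + m + k + 1 : ℚ))) *
    ∏ k ∈ Finset.Ico (j + 1) n, (C 2 * X + C (n + k : ℚ))

lemma eval_colPoly (m n j : ℕ) (x : ℚ) : (colPoly m n j).eval x =
    (∏ k ∈ Finset.range j, (x + (n + m + k + 1))) *
      ∏ k ∈ Finset.Ico (j + 1) n, (2 * x + (n + k)) := by
  simp [colPoly, eval_prod]

lemma natDegree_colPoly_lt (m : ℕ) {n j : ℕ} (h : j < n) : (colPoly m n j).natDegree < n := by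
  have h1 : (∏ k ∈ Finset.range j, (X + C (n + m + k + 1 : ℚ))).natDegree ≤ j := by
    refine (natDegree_prod_le _ _).trans ?_
    refine (Finset.sum_le_card_nsmul _ _ 1 fun k _ => ?_).trans (by simp)
    exact natDegree_X_add_C _ |>.le
  have h2 : (∏ k ∈ Finset.Ico (j + 1) n, (C 2 * X + C (n + k : ℚ))).natDegree ≤ n - (j + 1) := by
    refine (natDegree_prod_le _ _).trans ?_
    refine (Finset.sum_le_card_nsmul _ _ 1 fun k _ => ?_).trans (by simp)
    exact natDegree_linear_le
  have := natDegree_mul_le (p := ∏ k ∈ Finset.range j, (X + C (n + m + k + 1 : ℚ)))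
    (q := ∏ k ∈ Finset.Ico (j + 1) n, (C 2 * X + C (n + k : ℚ)))
  rw [colPoly]; omega

lemma prod_range_add_succ (a k : ℕ) :
    ∏ t ∈ Finset.range k, ((a : ℚ) + t + 1) = (a + k).factorial / a.factorial := by
  rw [eq_div_iff (by exact_mod_cast a.factorial_ne_zero)]
  induction k with
  | zero => simp
  | succ k ih =>
    rw [Finset.prod_range_succ, mul_right_comm, ih, ← add_assoc, Nat.factorial_succ]
    push_cast; ring

lemma binomMat_eq (m n : ℕ) (i j : Fin n) : binomMat m n i j =
    ((n + m - (i : ℕ)).factorial : ℚ) / ((m + i).factorial * (2 * n - 1 - 2 * (i : ℕ)).factorial) *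
      (colPoly m n j).eval (-(i : ℕ) : ℚ) := by
  rw [eval_colPoly, binomMat]
  rcases Nat.lt_or_ge (n + j) (2 * i) with h | h
  · rw [Nat.choose_eq_zero_of_lt (by omega)]
    rw [Finset.prod_eq_zero (i := 2 * (i : ℕ) - n) (s := Finset.Ico ((j : ℕ) + 1) n)]
    · simp
    · rw [Finset.mem_Ico]; omega
    · rw [Nat.cast_sub (by omega)]; push_cast; ring
  · obtain ⟨B, hB⟩ := Nat.exists_eq_add_of_le h
    obtain ⟨A, hA⟩ := Nat.exists_eq_add_of_le (show (i : ℕ) ≤ n + m by omega)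
    have hA' : (n : ℚ) + m = i + A := by exact_mod_cast hA
    have hB' : (n : ℚ) + j = 2 * i + B := by exact_mod_cast hB
    have e1 : ∏ k ∈ Finset.range (j : ℕ), (-(i : ℕ) + ((n : ℚ) + m + k + 1)) =
        (A + j).factorial / A.factorial := by
      rw [← prod_range_add_succ]
      exact Finset.prod_congr rfl fun k _ => by rw [hA']; ring
    have e2 : ∏ k ∈ Finset.Ico ((j : ℕ) + 1) n, (2 * -(i : ℚ) + ((n : ℚ) + k)) =
        (B + (n - (j + 1))).factorial / B.factorial := by
      rw [← prod_range_add_succ, Finset.prod_Ico_eq_prod_range]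
      exact Finset.prod_congr rfl fun k _ => by push_cast; linear_combination hB'
    have e3 := Nat.add_choose_mul_factorial_mul_factorial B (m + i)
    rw [e1, e2, show n + m - (i : ℕ) = A by omega, show 2 * n - 1 - 2 * (i : ℕ) = B + (n - (j + 1)) by omega,
      show A + j = B + (m + i) by omega, ← e3]
    have f1 : (A.factorial : ℚ) ≠ 0 := by exact_mod_cast A.factorial_ne_zero
    have f2 : (B.factorial : ℚ) ≠ 0 := by exact_mod_cast B.factorial_ne_zero
    have f3 : ((m + i).factorial : ℚ) ≠ 0 := by exact_mod_cast (m + (i : ℕ)).factorial_ne_zero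
    have f4 : ((B + (n - (j + 1))).factorial : ℚ) ≠ 0 := by
      exact_mod_cast (B + (n - ((j : ℕ) + 1))).factorial_ne_zero
    push_cast
    field_simp

lemma det_eval_colPoly_half (m n : ℕ) :
    Matrix.det (.of fun i j : Fin n => (colPoly m n j).eval (-((n : ℚ) + (i : ℕ)) / 2)) =
      ∏ k ∈ Finset.range n, ((1 / 2 : ℚ) ^ k * ((n - 1 - k).factorial *
        ∏ l ∈ Finset.range k, ((n : ℚ) - k + 2 * m + 2 * l + 2))) := by
  rw [← Fin.prod_univ_eq_prod_range (fun k => ((1 / 2 : ℚ) ^ k * ((n - 1 - k).factorial *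
        ∏ l ∈ Finset.range k, ((n : ℚ) - k + 2 * m + 2 * l + 2)))) n, det_of_isUpperTriangular]
  · refine Finset.prod_congr rfl fun k _ => ?_
    rw [of_apply, eval_colPoly]
    have e1 : ∏ l ∈ Finset.range (k : ℕ), (-((n : ℚ) + (k : ℕ)) / 2 + (n + m + l + 1)) =
        (1 / 2) ^ (k : ℕ) * ∏ l ∈ Finset.range (k : ℕ), ((n : ℚ) - (k : ℕ) + 2 * m + 2 * l + 2) := by
      conv_rhs => rw [← Finset.card_range (k : ℕ), ← Finset.prod_const, Finset.card_range,
        ← Finset.prod_mul_distrib]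
      exact Finset.prod_congr rfl fun l _ => by ring
    have e2 : ∏ l ∈ Finset.Ico ((k : ℕ) + 1) n, (2 * (-((n : ℚ) + (k : ℕ)) / 2) + (n + l)) =
        (n - 1 - (k : ℕ)).factorial := by
      rw [Finset.prod_Ico_eq_prod_range, show n - 1 - (k : ℕ) = 0 + (n - (k + 1)) by omega]
      have := prod_range_add_succ 0 (n - ((k : ℕ) + 1))
      rw [Nat.factorial_zero, Nat.cast_one, div_one] at this
      rw [← this]
      exact Finset.prod_congr rfl fun l _ => by push_cast; ring
    rw [e1, e2]; ring
  · intro i j hij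
    have hij' : (j : ℕ) < i := hij
    rw [of_apply, eval_colPoly]
    rw [Finset.prod_eq_zero (i := (i : ℕ)) (s := Finset.Ico ((j : ℕ) + 1) n), mul_zero]
    · rw [Finset.mem_Ico]; omega
    · ring

lemma det_binomMat (m n : ℕ) : (binomMat m n).det = ∏ k ∈ Finset.range n,
    (((n + m - k).factorial : ℚ) / ((m + k).factorial * (2 * n - 1 - 2 * k).factorial) *
      ((n - 1 - k).factorial * ∏ l ∈ Finset.range k, ((n : ℚ) - k + 2 * m + 2 * l + 2))) := by
  have h : binomMat m n = Matrix.of fun i j : Fin n => (((n + m - (i : ℕ)).factorial : ℚ) /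
      ((m + i).factorial * (2 * n - 1 - 2 * (i : ℕ)).factorial)) *
        Matrix.of (fun i j : Fin n => (colPoly m n j).eval (-(i : ℕ) : ℚ)) i j := by
    ext i j; exact binomMat_eq m n i j
  rw [h, det_mul_column (fun i : Fin n => ((n + m - (i : ℕ)).factorial : ℚ) /
    ((m + i).factorial * (2 * n - 1 - 2 * (i : ℕ)).factorial)), Finset.prod_mul_distrib]
  congr 1
  · exact Fin.prod_univ_eq_prod_range (fun i => (((n + m - i).factorial : ℚ) /
      ((m + i).factorial * (2 * n - 1 - 2 * i).factorial))) n
  have hv := det_eval_mul_det_vandermonde (fun j : Fin n => colPoly m n j)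
    (fun j => natDegree_colPoly_lt m j.2) (fun i => -(i : ℕ)) (fun i => -((n : ℚ) + (i : ℕ)) / 2)
  have hy : (vandermonde (fun i : Fin n => -((n : ℚ) + (i : ℕ)) / 2)).det =
      (∏ k ∈ Finset.range n, (1 / 2 : ℚ) ^ k) *
        (vandermonde (fun i : Fin n => -((i : ℕ) : ℚ))).det := by
    rw [← Finset.prod_range_reflect, ← Fin.prod_univ_eq_prod_range
      (fun k => (1 / 2 : ℚ) ^ (n - 1 - k)), det_vandermonde, det_vandermonde,
      ← Finset.prod_mul_distrib]
    refine Finset.prod_congr rfl fun i _ => ?_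
    rw [← Fin.card_Ioi i, ← Finset.prod_const, ← Finset.prod_mul_distrib]
    exact Finset.prod_congr rfl fun j _ => by ring
  have hx : (vandermonde (fun i : Fin n => -((i : ℕ) : ℚ))).det ≠ 0 := by
    rw [det_vandermonde_ne_zero_iff]
    intro i j hij
    simpa [Fin.ext_iff] using hij
  rw [hy, det_eval_colPoly_half, Finset.prod_mul_distrib] at hv
  have h2 : (∏ k ∈ Finset.range n, (1 / 2 : ℚ) ^ k) ≠ 0 :=
    Finset.prod_ne_zero_iff.mpr fun k _ => by positivity
  apply mul_right_cancel₀ (mul_ne_zero h2 hx)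
  rw [hv]; ring

/-- Consecutive quotients of the specializations for block reversals. -/
noncomputable def revRatio (m q : ℕ) : ℚ :=
  ((2 * m + 2 * q).factorial * q.factorial : ℚ) / ((2 * m + q).factorial * (2 * q).factorial)

lemma revRatio_pos (m q : ℕ) : 0 < revRatio m q := by
  unfold revRatio
  have := (2 * m + 2 * q).factorial_pos
  have := q.factorial_pos
  have := (2 * m + q).factorial_pos
  have := (2 * q).factorial_pos
  positivity

lemma prod_prod_succ (m n : ℕ) :
    ∏ k ∈ Finset.range (n + 1), ∏ l ∈ Finset.range k, (((n + 1 : ℕ) : ℚ) - k + 2 * m + 2 * l + 2) =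
      (∏ k ∈ Finset.range n, ∏ l ∈ Finset.range k, ((n : ℚ) - k + 2 * m + 2 * l + 2)) *
        ((2 * m + 2 * n + 1).factorial / (2 * m + n + 1).factorial) := by
  have key : ∏ k ∈ Finset.range n, ((2 * m + n + 1 : ℕ) + (k : ℚ) + 1) =
      (2 * m + 2 * n + 1).factorial / (2 * m + n + 1).factorial := by
    rw [prod_range_add_succ]
    congr 3; ring
  rw [← key, Finset.prod_range_succ', Finset.prod_range_zero, mul_one, ← Finset.prod_mul_distrib]
  refine Finset.prod_congr rfl fun k _ => ?_
  rw [Finset.prod_range_succ]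
  congr 1
  · exact Finset.prod_congr rfl fun l _ => by push_cast; ring
  · push_cast; ring

lemma det_binomMat_eq_prod (m n : ℕ) :
    (binomMat m n).det = ∏ q ∈ Finset.range (n + 1), revRatio m q := by
  have hf : ∀ k : ℕ, (k.factorial : ℚ) ≠ 0 := fun k => by exact_mod_cast k.factorial_ne_zero
  have h1 : ∀ n, (∏ k ∈ Finset.range n, ((n + m - k).factorial : ℚ)) =
      (m + n).factorial / m.factorial * ∏ k ∈ Finset.range n, ((m + k).factorial : ℚ) := by
    intro n
    rw [← Finset.prod_range_reflect]
    have : ∏ k ∈ Finset.range n, ((n + m - (n - 1 - k)).factorial : ℚ) =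
        ∏ k ∈ Finset.range n, ((m + (k + 1)).factorial : ℚ) :=
      Finset.prod_congr rfl fun k hk => by
        rw [Finset.mem_range] at hk
        rw [show n + m - (n - 1 - k) = m + (k + 1) by omega]
    rw [this, div_mul_eq_mul_div, eq_div_iff (hf _), mul_comm ((m + n).factorial : ℚ)]
    exact (Finset.prod_range_succ' (fun k => ((m + k).factorial : ℚ)) n).symm.trans
      (Finset.prod_range_succ _ n)
  have h2 : ∀ n, (∏ k ∈ Finset.range n, ((2 * n - 1 - 2 * k).factorial : ℚ)) =
      ∏ k ∈ Finset.range n, ((2 * k + 1).factorial : ℚ) := by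
    intro n
    rw [← Finset.prod_range_reflect]
    refine Finset.prod_congr rfl fun k hk => ?_
    rw [Finset.mem_range] at hk
    rw [show 2 * n - 1 - 2 * (n - 1 - k) = 2 * k + 1 by omega]
  have h3 : ∀ n, (∏ k ∈ Finset.range n, ((n - 1 - k).factorial : ℚ)) =
      ∏ k ∈ Finset.range n, (k.factorial : ℚ) :=
    fun n => Finset.prod_range_reflect (fun k => (k.factorial : ℚ)) n
  have h4 : ∀ n, ∏ k ∈ Finset.range n, ((m + k).factorial : ℚ) ≠ 0 := fun n =>
    Finset.prod_ne_zero_iff.mpr fun k _ => hf _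
  have h5 : ∀ n, ∏ k ∈ Finset.range n, ((2 * k + 1).factorial : ℚ) ≠ 0 := fun n =>
    Finset.prod_ne_zero_iff.mpr fun k _ => hf _
  have hF : ∀ n, (binomMat m n).det = (m + n).factorial / m.factorial /
      (∏ k ∈ Finset.range n, ((2 * k + 1).factorial : ℚ)) * ((∏ k ∈ Finset.range n, (k.factorial : ℚ)) *
        ∏ k ∈ Finset.range n, ∏ l ∈ Finset.range k, ((n : ℚ) - k + 2 * m + 2 * l + 2)) := by
    intro n
    rw [det_binomMat, Finset.prod_mul_distrib, Finset.prod_mul_distrib, Finset.prod_div_distrib,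
      Finset.prod_mul_distrib, h1, h2, h3]
    have := h4 n
    have := h5 n
    have := hf m
    field_simp
  induction n with
  | zero =>
    rw [hF]
    have := hf m
    have := hf (2 * m)
    simp [revRatio, *]
  | succ n ih =>
    rw [Finset.prod_range_succ, ← ih, hF, hF, prod_prod_succ, Finset.prod_range_succ,
      Finset.prod_range_succ, revRatio]
    have e1 : ((2 * m + 2 * (n + 1)).factorial : ℚ) =
        (2 * m + 2 * n + 2) * (2 * m + 2 * n + 1).factorial := by
      rw [show 2 * m + 2 * (n + 1) = 2 * m + 2 * n + 1 + 1 by ring, Nat.factorial_succ]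
      push_cast; ring
    have e2 : ((2 * (n + 1)).factorial : ℚ) = (2 * n + 2) * (2 * n + 1).factorial := by
      rw [show 2 * (n + 1) = 2 * n + 1 + 1 by ring, Nat.factorial_succ]; push_cast; ring
    have e3 : ((n + 1).factorial : ℚ) = (n + 1) * n.factorial := by
      rw [Nat.factorial_succ]; push_cast; ring
    have e4 : ((m + (n + 1)).factorial : ℚ) = (m + n + 1) * (m + n).factorial := by
      rw [← add_assoc, Nat.factorial_succ]; push_cast; ring
    rw [e1, e2, e3, e4, show 2 * m + (n + 1) = 2 * m + n + 1 by ring]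
    have := h5 n
    have := hf m
    have := hf (2 * m + n + 1)
    have := hf (2 * n + 1)
    have : (n : ℚ) + 1 ≠ 0 := by positivity
    have : (2 * n + 2 : ℚ) ≠ 0 := by positivity
    field_simp

/-- The principal specialization of the Schubert polynomial of a block reversal. -/
lemma upsilon_blockRev (m c : ℕ) (hc : 0 < c) :
    Upsilon (m + c) (blockRev m c) = ∏ q ∈ Finset.range c, revRatio m q := by
  obtain ⟨n, rfl⟩ := Nat.exists_eq_add_of_le' hc
  rw [upsilon_blockRev_eq_det, det_binomMat_eq_prod]
  rw [det_binomMat_eq_prod]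
  exact (Finset.prod_pos fun q _ => revRatio_pos m q).ne'

end Layered

namespace Layered

lemma len_mul_upsilon_eq_sum (n : ℕ) (w : Equiv.Perm ℕ) :
    (len n w : ℚ) * Upsilon n w = ∑ i ∈ Finset.Ico 1 n,
      if w (i + 1) < w i then (i : ℚ) * Upsilon n (w * sT i) else 0 := by
  rw [← Finset.sum_filter]
  by_cases h : len n w = 0
  · rw [h, Nat.cast_zero, zero_mul, Finset.sum_eq_zero]
    intro i hi
    rw [Finset.mem_filter, Finset.mem_Ico] at hi
    have := len_mul_sT_of_desc w hi.1.1 hi.1.2 hi.2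
    omega
  · exact len_mul_upsilon n w h

section DirectSum

variable {m n : ℕ} {u w : Equiv.Perm ℕ}

lemma mul_apply_of_le (hw : Supp m n w) {x : ℕ} (hx : x ≤ m) : (u * w) x = u x := by
  rw [Equiv.Perm.mul_apply, hw x (Or.inl hx)]

lemma mul_apply_of_gt (hu : Supp 0 m u) (hw : Supp m n w) {x : ℕ} (hx : m < x) (hxn : x ≤ n) :
    (u * w) x = w x := by
  rw [Equiv.Perm.mul_apply, hu _ (Or.inr (hw.map_mem hx hxn).1)]

lemma Supp.map_le (hu : Supp 0 m u) {x : ℕ} (hx : x ≤ m) : u x ≤ m := by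
  rcases Nat.eq_zero_or_pos x with rfl | h
  · rw [hu 0 (Or.inl le_rfl)]; exact hx
  · exact (hu.map_mem h hx).2

lemma len_mul_of_supp (hmn : m ≤ n) (hu : Supp 0 m u) (hw : Supp m n w) :
    len n (u * w) = len m u + len n w := by
  unfold len
  rw [← Finset.card_union_of_disjoint]
  · congr 1
    ext ⟨x, y⟩
    simp only [Finset.mem_union, Finset.mem_filter, Finset.mem_product, Finset.mem_Icc]
    rcases le_or_gt y m with hy | hy
    · rcases le_or_gt x m with hx | hx
      · rw [mul_apply_of_le hw hx, mul_apply_of_le hw hy, hw x (Or.inl hx), hw y (Or.inl hy)]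
        omega
      · omega
    · rcases le_or_gt y n with hyn | hyn
      · have h1 := (hw.map_mem hy hyn).1
        rw [mul_apply_of_gt hu hw hy hyn]
        rcases le_or_gt x m with hx | hx
        · rw [mul_apply_of_le hw hx, hw x (Or.inl hx)]
          have := hu.map_le hx
          omega
        · rcases le_or_gt x n with hxn | hxn
          · rw [mul_apply_of_gt hu hw hx hxn]
            omega
          · omega
      · omega
  · rw [Finset.disjoint_left]
    rintro ⟨x, y⟩ h1 h2
    simp only [Finset.mem_filter, Finset.mem_product, Finset.mem_Icc] at h1 h2
    rw [hw x (by omega), hw y (by omega)] at h2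
    omega

lemma Supp.mul_sT_comm (hw : Supp m n w) {i : ℕ} (hi : i < m) : w * sT i = sT i * w := by
  ext x
  rcases le_or_gt x m with h | h
  · rw [Equiv.Perm.mul_apply, Equiv.Perm.mul_apply, hw x (Or.inl h), sT_apply]
    split_ifs <;> exact hw _ (Or.inl (by omega))
  · have h1 : m < w x := by
      rcases le_or_gt x n with h' | h'
      · exact (hw.map_mem h h').1
      · rwa [hw x (Or.inr h')]
    rw [Equiv.Perm.mul_apply, Equiv.Perm.mul_apply, sT_apply, sT_apply, if_neg (by omega),
      if_neg (by omega), if_neg (by omega), if_neg (by omega)]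

/-- Principal specializations are multiplicative with respect to direct sums. -/
lemma upsilon_mul (hmn : m ≤ n) (hu : Supp 0 m u) (hw : Supp m n w) :
    Upsilon n (u * w) = Upsilon m u * Upsilon n w := by
  induction hk : len n (u * w) using Nat.strong_induction_on generalizing u w with
  | _ k ih =>
  have hl := len_mul_of_supp hmn hu hw
  by_cases h0 : k = 0
  · have hw0 : Supp 0 n w := fun x hx => hw x (by omega)
    rw [hu.eq_one_of_len (by omega), hw0.eq_one_of_len (by omega), mul_one, upsilon_one,
      upsilon_one, mul_one]
  have hk0 : (len n (u * w) : ℚ) ≠ 0 := by rw [hk]; exact_mod_cast h0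
  apply mul_left_cancel₀ hk0
  rw [len_mul_upsilon_eq_sum]
  have e1 := len_mul_upsilon_eq_sum m u
  have e2 := len_mul_upsilon_eq_sum n w
  have e3 : ∑ i ∈ Finset.Ico 1 m, (if u (i + 1) < u i then (i : ℚ) * Upsilon m (u * sT i) else 0) =
      ∑ i ∈ Finset.Ico 1 n,
        if i < m ∧ u (i + 1) < u i then (i : ℚ) * Upsilon m (u * sT i) else 0 := by
    rw [← Finset.sum_filter, ← Finset.sum_filter]
    refine Finset.sum_congr ?_ fun _ _ => rfl
    ext i
    simp only [Finset.mem_filter, Finset.mem_Ico]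
    omega
  have : (len n (u * w) : ℚ) * (Upsilon m u * Upsilon n w) =
      (len m u * Upsilon m u) * Upsilon n w + (len n w * Upsilon n w) * Upsilon m u := by
    rw [hl]; push_cast; ring
  rw [this, e1, e2, e3, Finset.sum_mul, Finset.sum_mul, ← Finset.sum_add_distrib]
  refine Finset.sum_congr rfl fun i hi => ?_
  rw [Finset.mem_Ico] at hi
  rcases lt_trichotomy i m with h | h | h
  · rw [mul_apply_of_le hw h, mul_apply_of_le hw h.le, hw i (Or.inl h.le), hw (i + 1) (Or.inl h),
      if_neg (show ¬ (i + 1 < i) by omega)]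
    simp only [h, true_and]
    split_ifs with hd
    · have hd' : (u * w) (i + 1) < (u * w) i := by
        rwa [mul_apply_of_le hw h, mul_apply_of_le hw h.le]
      have := len_mul_sT_of_desc _ hi.1 hi.2 hd'
      have e : u * w * sT i = u * sT i * w := by rw [mul_assoc, hw.mul_sT_comm h, mul_assoc]
      rw [e] at this ⊢
      rw [ih _ (by omega) (hu.mul_sT (by omega) h) hw rfl]
      ring
    · ring
  · subst h
    have h1 : i < w (i + 1) ∧ w (i + 1) ≤ n := hw.map_mem (by omega) hi.2
    have h2 := hu.map_le (le_refl i)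
    rw [mul_apply_of_le hw le_rfl, mul_apply_of_gt hu hw (show i < i + 1 by omega) hi.2,
      hw i (Or.inl le_rfl), if_neg (by omega), if_neg (by omega), if_neg (by omega)]
    ring
  · rw [mul_apply_of_gt hu hw h hi.2.le, mul_apply_of_gt hu hw (by omega) hi.2,
      if_neg (show ¬ (i < m ∧ _) by omega)]
    split_ifs with hd
    · have hd' : (u * w) (i + 1) < (u * w) i := by
        rwa [mul_apply_of_gt hu hw h hi.2.le, mul_apply_of_gt hu hw (by omega) hi.2]
      have := len_mul_sT_of_desc _ hi.1 hi.2 hd'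
      rw [mul_assoc] at this ⊢
      rw [ih _ (by omega) hu (hw.mul_sT h hi.2) rfl]
      ring
    · ring

end DirectSum

lemma layeredPerm_append (b : List ℕ) (c : ℕ) :
    layeredPerm (b ++ [c]) = layeredPerm b * blockRev b.sum c := by
  unfold layeredPerm
  rw [List.length_append, List.length_singleton, List.range_succ, List.map_append,
    List.prod_append]
  congr 1
  · congr 1
    refine List.map_congr_left fun j hj => ?_
    rw [List.mem_range] at hj
    rw [List.take_append_of_le_length hj.le, List.getD_append _ _ _ _ hj]
  · simp

lemma supp_layeredPerm (b : List ℕ) : Supp 0 b.sum (layeredPerm b) := by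
  induction b using List.reverseRecOn with
  | nil => intro x _; simp [layeredPerm]
  | append_singleton b c ih =>
    rw [layeredPerm_append, List.sum_append, List.sum_singleton]
    refine Supp.mul (fun x hx => ih x (by omega)) fun x hx => supp_blockRev b.sum c x (by omega)

lemma upsilon_layeredPerm_append (b : List ℕ) {c : ℕ} (hc : 0 < c) :
    Upsilon (b ++ [c]).sum (layeredPerm (b ++ [c])) =
      Upsilon b.sum (layeredPerm b) * ∏ q ∈ Finset.range c, revRatio b.sum q := by
  rw [layeredPerm_append, List.sum_append, List.sum_singleton,
    upsilon_mul (Nat.le_add_right _ _) (supp_layeredPerm b) (supp_blockRev b.sum c),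
    upsilon_blockRev _ _ hc]

lemma upsilon_layeredPerm_nil : Upsilon 0 (layeredPerm []) = 1 := by
  simpa [layeredPerm] using upsilon_one 0

lemma upsilon_layeredPerm_pos (b : List ℕ) (hb : ∀ c ∈ b, 0 < c) :
    0 < Upsilon b.sum (layeredPerm b) := by
  induction b using List.reverseRecOn with
  | nil => simp [upsilon_layeredPerm_nil]
  | append_singleton b c ih =>
    rw [upsilon_layeredPerm_append b (hb c (by simp))]
    exact mul_pos (ih fun x hx => hb x (by simp [hx]))
      (Finset.prod_pos fun q _ => revRatio_pos _ q)

end Layered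

namespace Layered

open Real

section LimitFunction

lemma hasDerivAt_sq_mul_log (x : ℝ) :
    HasDerivAt (fun t => t ^ 2 * log t) (2 * x * log x + x) x := by
  rcases eq_or_ne x 0 with rfl | hx
  · have h : HasDerivAt (fun t : ℝ => t * (t * log t)) 0 0 := by
      rw [hasDerivAt_iff_tendsto_slope]
      have h0 := continuous_mul_log.tendsto 0
      simp only [zero_mul] at h0
      refine (h0.mono_left nhdsWithin_le_nhds).congr' ?_
      filter_upwards [self_mem_nhdsWithin] with t ht
      have ht' : t ≠ 0 := ht
      simp [slope_def_field, ht']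
    simpa [pow_two, mul_assoc] using h
  · refine ((hasDerivAt_pow 2 x).mul (hasDerivAt_log hx)).congr_deriv ?_
    field_simp
    norm_num
    ring

lemma hasDerivAt_f (x : ℝ) :
    HasDerivAt f (2 * x * log x + (1 - x) * log (1 - x) - (1 + x) * log (1 + x)
      + 2 * log 2) x := by
  have h1 := hasDerivAt_sq_mul_log x
  have h2 := (hasDerivAt_sq_mul_log (1 - x)).comp x ((hasDerivAt_id x).const_sub 1)
  have h3 := (hasDerivAt_sq_mul_log (1 + x)).comp x ((hasDerivAt_id x).const_add 1)
  have h4 := ((hasDerivAt_id x).const_mul 2).mul_const (log 2)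
  have h := ((h1.sub (h2.const_mul (1 / 2))).sub (h3.const_mul (1 / 2))).add h4
  refine (h.congr_deriv ?_).congr_of_eventuallyEq (Filter.Eventually.of_forall fun t => ?_)
  · ring
  · simp only [f, Function.comp, Pi.add_apply, Pi.sub_apply, id]
    ring

lemma continuous_f : Continuous f :=
  continuous_iff_continuousAt.2 fun x => (hasDerivAt_f x).continuousAt

lemma f_zero : f 0 = 0 := by simp [f]

lemma f_one : f 1 = 0 := by norm_num [f]

lemma f_half_pos : 0 < f (1 / 2) := by
  have h1 : f (1 / 2) = 2 * log 2 - 9 / 8 * log 3 := by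
    have e1 : log (1 / 2) = - log 2 := by rw [one_div, log_inv]
    have e2 : log (3 / 2) = log 3 - log 2 := log_div (by norm_num) (by norm_num)
    unfold f
    rw [show (1 : ℝ) - 1 / 2 = 1 / 2 by norm_num, show (1 : ℝ) + 1 / 2 = 3 / 2 by norm_num, e1, e2]
    ring
  have h2 : log ((3 : ℝ) ^ 9) < log (2 ^ 16) := log_lt_log (by norm_num) (by norm_num)
  rw [log_pow, log_pow] at h2
  push_cast at h2
  linarith

/-- The unique critical point of `f x / (1 - x ^ 2)` is its global maximum on `[0, 1]`. -/
lemma f_le_of_unique_critical {α : ℝ}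
    (huniq : ∀ β ∈ Set.Ioo (0 : ℝ) 1, 2 * β * f β + (1 - β ^ 2) * deriv f β = 0 → β = α)
    {x : ℝ} (hx : x ∈ Set.Icc (0 : ℝ) 1) :
    f x ≤ f α / (1 - α ^ 2) * (1 - x ^ 2) := by
  set G : ℝ → ℝ := fun x => - dslope f 1 x / (1 + x) with hG
  have hf : ∀ y ∈ Set.Icc (0 : ℝ) 1, f y = (1 - y ^ 2) * G y := fun y hy => by
    have h := sub_smul_dslope f 1 y
    rw [f_one, sub_zero, smul_eq_mul] at h
    have h1 : (1 : ℝ) + y ≠ 0 := by linarith [hy.1]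
    rw [← h, hG]
    field_simp
    ring
  have hc : ContinuousOn G (Set.Icc 0 1) := by
    refine ContinuousOn.div ?_ (by fun_prop) fun y hy => by linarith [hy.1]
    refine ContinuousOn.neg (Continuous.continuousOn ?_)
    rw [← continuousOn_univ, continuousOn_dslope Filter.univ_mem]
    exact ⟨continuous_f.continuousOn, (hasDerivAt_f 1).differentiableAt⟩
  obtain ⟨β, hβ, hmax⟩ := isCompact_Icc.exists_isMaxOn (Set.nonempty_Icc.2 zero_le_one) hc
  have hmax' : ∀ y ∈ Set.Icc (0 : ℝ) 1, G y ≤ G β := fun y hy => hmax hy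
  have hpos : 0 < G β := by
    have h2 : (1 / 2 : ℝ) ∈ Set.Icc (0 : ℝ) 1 := by constructor <;> norm_num
    have := hf _ h2
    have := f_half_pos
    have := hmax' _ h2
    norm_num at *
    linarith
  have hle : ∀ y ∈ Set.Icc (0 : ℝ) 1, f y ≤ G β * (1 - y ^ 2) := fun y hy => by
    rw [hf y hy, mul_comm]
    exact mul_le_mul_of_nonneg_right (hmax' y hy) (by nlinarith [hy.1, hy.2])
  have hd1 := hasDerivAt_f 1
  have h0 : β ≠ 0 := by
    rintro rfl
    have := hf 0 hβ
    rw [f_zero] at this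
    norm_num at this
    linarith
  have h1 : β ≠ 1 := by
    rintro rfl
    have : G 1 = 0 := by
      have : deriv f 1 = 0 := by rw [hd1.deriv]; norm_num
      simp [hG, this]
    linarith
  have hβ' : β ∈ Set.Ioo (0 : ℝ) 1 := ⟨hβ.1.lt_of_ne' h0, hβ.2.lt_of_ne h1⟩
  have hd : HasDerivAt (fun y => f y - G β * (1 - y ^ 2)) (deriv f β + G β * (2 * β)) β := by
    refine ((hasDerivAt_f β).differentiableAt.hasDerivAt.sub
      (((hasDerivAt_pow 2 β).const_sub 1).const_mul (G β))).congr_deriv ?_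
    norm_num
  have hloc : IsLocalMax (fun y => f y - G β * (1 - y ^ 2)) β := by
    filter_upwards [Icc_mem_nhds hβ'.1 hβ'.2] with y hy
    have := hle y hy
    have := hf β hβ
    linarith
  have hcrit := hloc.hasDerivAt_eq_zero hd
  have hβα : β = α := by
    refine huniq β hβ' ?_
    have := hf β hβ
    linear_combination (1 - β ^ 2) * hcrit + 2 * β * this
  have hγ : f α / (1 - α ^ 2) = G β := by
    rw [← hβα, hf β hβ]
    have : 1 - β ^ 2 ≠ 0 := by nlinarith [hβ'.1, hβ'.2]
    field_simp
  rw [hγ]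
  exact hle x hx

end LimitFunction

section Factorial

lemma le_log_factorial (k : ℕ) : k * log k - k ≤ log (k.factorial) := by
  induction k with
  | zero => simp
  | succ k ih =>
    rw [Nat.factorial_succ]
    push_cast
    rw [log_mul (by positivity) (by positivity)]
    rcases Nat.eq_zero_or_pos k with rfl | hk
    · simp
    have hk' : (0 : ℝ) < k := by exact_mod_cast hk
    have h := log_le_sub_one_of_pos (show (0 : ℝ) < (k + 1) / k by positivity)
    rw [log_div (by positivity) (by positivity)] at h
    have h' : (k : ℝ) * (log (k + 1) - log k) ≤ k * ((k + 1) / k - 1) := by gcongr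
    have e : (k : ℝ) * ((k + 1) / k - 1) = 1 := by field_simp; ring
    linarith

lemma log_factorial_le {k N : ℕ} (hkN : k ≤ N) :
    log (k.factorial) ≤ k * log k - k + (1 + log (N + 1)) := by
  suffices h : ∀ k : ℕ, log (k.factorial) ≤ k * log k - k + (1 + log (k + 1)) by
    refine (h k).trans ?_
    gcongr
  intro k
  rcases Nat.eq_zero_or_pos k with rfl | hk
  · simp
  suffices h : log (k.factorial) ≤ k * log k - k + (1 + log k) by
    refine h.trans ?_
    gcongr
    linarith
  induction k, hk using Nat.le_induction with
  | base => simp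
  | succ k hk ih =>
    rw [Nat.factorial_succ]
    push_cast
    rw [log_mul (by positivity) (by positivity)]
    have hk' : (0 : ℝ) < k := by exact_mod_cast hk
    have h := one_sub_inv_le_log_of_pos (show (0 : ℝ) < (k + 1) / k by positivity)
    rw [log_div (by positivity) (by positivity)] at h
    have h' : ((k : ℝ) + 1) * (1 - (((k : ℝ) + 1) / k)⁻¹) ≤ (k + 1) * (log (k + 1) - log k) := by gcongr
    have e : ((k : ℝ) + 1) * (1 - (((k : ℝ) + 1) / k)⁻¹) = 1 := by field_simp; ring
    linarith

end Factorial

end Layered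

namespace Layered

open Real

section BlockAsymptotics

variable (m : ℝ)

/-- The leading order of `log (revRatio m t)`. -/
noncomputable def rate (t : ℝ) : ℝ :=
  2 * m * log 2 + 2 * ((m + t) * log (m + t)) - t * log t - (2 * m + t) * log (2 * m + t)

/-- An antiderivative of `rate m`. -/
noncomputable def ratePrimitive (t : ℝ) : ℝ :=
  m ^ 2 * log m - 1 / 2 * (t ^ 2 * log t) - 1 / 2 * ((2 * m + t) ^ 2 * log (2 * m + t))
    + (m + t) ^ 2 * log (m + t) + 2 * m * (m + t) * log 2

lemma hasDerivAt_ratePrimitive (t : ℝ) : HasDerivAt (ratePrimitive m) (rate m t) t := by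
  have h1 := hasDerivAt_sq_mul_log t
  have h2 := (hasDerivAt_sq_mul_log (2 * m + t)).comp t ((hasDerivAt_id t).const_add (2 * m))
  have h3 := (hasDerivAt_sq_mul_log (m + t)).comp t ((hasDerivAt_id t).const_add m)
  have h4 := (((hasDerivAt_id t).const_add m).const_mul (2 * m)).mul_const (log 2)
  have h := ((((h1.const_mul (1 / 2)).const_sub (m ^ 2 * log m)).sub
    (h2.const_mul (1 / 2))).add h3).add h4
  refine (h.congr_deriv ?_).congr_of_eventuallyEq (Filter.Eventually.of_forall fun t => ?_)
  · unfold rate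
    ring
  · simp only [ratePrimitive, Function.comp, Pi.add_apply, Pi.sub_apply, id]

lemma continuous_rate : Continuous (rate m) := by
  have h : ∀ a : ℝ, Continuous fun t : ℝ => (a + t) * log (a + t) := fun a =>
    continuous_mul_log.comp (continuous_const.add continuous_id)
  unfold rate
  exact ((continuous_const.add (continuous_const.mul (h m))).sub continuous_mul_log).sub (h (2 * m))

variable {m}

lemma monotoneOn_rate (hm : 0 ≤ m) : MonotoneOn (rate m) (Set.Ici 0) := by
  have hd : ∀ t : ℝ, 0 < t →
      HasDerivAt (rate m) (2 * log (m + t) - log t - log (2 * m + t)) t := fun t ht => by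
    have h1 := hasDerivAt_mul_log (show m + t ≠ 0 by positivity)
    have h2 := hasDerivAt_mul_log ht.ne'
    have h3 := hasDerivAt_mul_log (show 2 * m + t ≠ 0 by positivity)
    have h1 := h1.comp t ((hasDerivAt_id t).const_add m)
    have h3 := h3.comp t ((hasDerivAt_id t).const_add (2 * m))
    have h := (((h1.const_mul 2).const_add (2 * m * log 2)).sub h2).sub h3
    refine h.congr_deriv ?_
    ring
  refine monotoneOn_of_deriv_nonneg (convex_Ici 0) (continuous_rate m).continuousOn ?_ ?_
  · rw [interior_Ici]
    exact fun t ht => (hd t ht).differentiableAt.differentiableWithinAt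
  · rw [interior_Ici]
    intro t ht
    have ht : 0 < t := ht
    rw [(hd t ht).deriv]
    have : log (t * (2 * m + t)) ≤ log ((m + t) ^ 2) :=
      log_le_log (by positivity) (by nlinarith [sq_nonneg m])
    rw [log_mul (by positivity) (by positivity), log_pow] at this
    push_cast at this
    linarith

lemma rate_zero : rate m 0 = 0 := by
  rcases eq_or_ne m 0 with rfl | hm
  · simp [rate]
  · unfold rate
    simp only [add_zero, zero_mul, log_mul two_ne_zero hm]
    ring

lemma rate_le (hm : 0 ≤ m) {t : ℝ} (ht : 0 ≤ t) : rate m t ≤ 2 * m := by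
  have h := convexOn_mul_log.2 (show t ∈ Set.Ici (0 : ℝ) from ht)
    (show 2 * m + t ∈ Set.Ici (0 : ℝ) by simp; positivity)
    (show (0 : ℝ) ≤ 1 / 2 by norm_num) (show (0 : ℝ) ≤ 1 / 2 by norm_num) (by norm_num)
  simp only [smul_eq_mul] at h
  rw [show 1 / 2 * t + 1 / 2 * (2 * m + t) = m + t by ring] at h
  have h2 : m * log 2 ≤ m * 1 := by
    gcongr
    have := log_two_lt_d9
    linarith
  unfold rate
  linarith

lemma ratePrimitive_zero : ratePrimitive m 0 = 0 := by
  rcases eq_or_ne m 0 with rfl | hm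
  · simp [ratePrimitive]
  · unfold ratePrimitive
    simp only [add_zero, log_mul two_ne_zero hm]
    ring

lemma ratePrimitive_eq (hm : 0 ≤ m) {p : ℝ} (hp : 0 < p) :
    ratePrimitive m p = (m + p) ^ 2 * f (m / (m + p)) := by
  have hn : 0 < m + p := by positivity
  have e1 : 1 - m / (m + p) = p / (m + p) := by field_simp; ring
  have e2 : 1 + m / (m + p) = (2 * m + p) / (m + p) := by field_simp; ring
  unfold f ratePrimitive
  rw [e1, e2, log_div hp.ne' hn.ne', log_div (show 2 * m + p ≠ 0 by positivity) hn.ne']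
  rcases eq_or_ne m 0 with rfl | hm0
  · simp at hn ⊢
    field_simp
    ring
  · rw [log_div hm0 hn.ne']
    field_simp
    ring

lemma sum_rate_le (hm : 0 ≤ m) (p : ℕ) :
    ∑ q ∈ Finset.range p, rate m q ≤ ratePrimitive m p := by
  induction p with
  | zero => simp [ratePrimitive_zero]
  | succ p ih =>
    obtain ⟨c, hc, h⟩ := exists_hasDerivAt_eq_slope (ratePrimitive m) (rate m)
      (show (p : ℝ) < p + 1 by linarith)
      (fun x _ => (hasDerivAt_ratePrimitive m x).continuousAt.continuousWithinAt)
      (fun x _ => hasDerivAt_ratePrimitive m x)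
    have hp : (0 : ℝ) ≤ p := by positivity
    have := monotoneOn_rate hm (show (p : ℝ) ∈ Set.Ici (0 : ℝ) from hp)
      (show c ∈ Set.Ici (0 : ℝ) from hp.trans hc.1.le) hc.1.le
    rw [h, add_sub_cancel_left, div_one] at this
    rw [Finset.sum_range_succ]
    push_cast
    linarith

lemma le_sum_rate (hm : 0 ≤ m) (p : ℕ) :
    ratePrimitive m p - 2 * m ≤ ∑ q ∈ Finset.range p, rate m q := by
  suffices h : ratePrimitive m p - rate m p ≤ ∑ q ∈ Finset.range p, rate m q by
    have := rate_le hm (show (0 : ℝ) ≤ p by positivity)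
    linarith
  induction p with
  | zero => simp [ratePrimitive_zero, rate_zero]
  | succ p ih =>
    obtain ⟨c, hc, h⟩ := exists_hasDerivAt_eq_slope (ratePrimitive m) (rate m)
      (show (p : ℝ) < p + 1 by linarith)
      (fun x _ => (hasDerivAt_ratePrimitive m x).continuousAt.continuousWithinAt)
      (fun x _ => hasDerivAt_ratePrimitive m x)
    have hp : (0 : ℝ) ≤ p := by positivity
    have := monotoneOn_rate hm (show c ∈ Set.Ici (0 : ℝ) from hp.trans hc.1.le)
      (show (p : ℝ) + 1 ∈ Set.Ici (0 : ℝ) by simp; linarith) hc.2.le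
    rw [h, add_sub_cancel_left, div_one] at this
    rw [Finset.sum_range_succ]
    push_cast
    linarith

/-- The error made by Stirling's approximation of `log (revRatio m q)` for `m + q ≤ n`. -/
noncomputable def stirlingError (n : ℕ) : ℝ := 2 * (1 + log (2 * n + 1))

lemma two_le_stirlingError (n : ℕ) : 2 ≤ stirlingError n := by
  have : 0 ≤ log (2 * (n : ℝ) + 1) := log_nonneg (by linarith [show (0 : ℝ) ≤ n by positivity])
  unfold stirlingError
  linarith

lemma stirlingError_mono : Monotone stirlingError := fun a b h => by
  unfold stirlingError
  gcongr

lemma abs_log_revRatio_sub_rate_le {m q n : ℕ} (h : m + q ≤ n) :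
    |log (revRatio m q : ℚ) - rate m q| ≤ stirlingError n := by
  have a1 := le_log_factorial (2 * m + 2 * q)
  have a2 := le_log_factorial q
  have a3 := le_log_factorial (2 * m + q)
  have a4 := le_log_factorial (2 * q)
  have b1 := log_factorial_le (show 2 * m + 2 * q ≤ 2 * n by omega)
  have b2 := log_factorial_le (show q ≤ 2 * n by omega)
  have b3 := log_factorial_le (show 2 * m + q ≤ 2 * n by omega)
  have b4 := log_factorial_le (show 2 * q ≤ 2 * n by omega)
  have e : log (revRatio m q : ℚ) = log ((2 * m + 2 * q).factorial) + log (q.factorial) -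
      (log ((2 * m + q).factorial) + log ((2 * q).factorial)) := by
    unfold revRatio
    push_cast
    rw [log_div (by positivity) (by positivity), log_mul (by positivity) (by positivity),
      log_mul (by positivity) (by positivity)]
  have e1 : (2 * q : ℝ) * log (2 * q) = 2 * q * log 2 + 2 * (q * log q) := by
    rcases Nat.eq_zero_or_pos q with rfl | hq
    · simp
    · rw [log_mul (by norm_num) (by positivity)]
      ring
  have e2 : (2 * m + 2 * q : ℝ) * log (2 * m + 2 * q) =
      2 * (m + q) * log 2 + 2 * ((m + q) * log (m + q)) := by
    rcases Nat.eq_zero_or_pos (m + q) with h0 | h0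
    · obtain ⟨rfl, rfl⟩ : m = 0 ∧ q = 0 := by omega
      simp
    · have h0 : (0 : ℝ) < m + q := by exact_mod_cast h0
      rw [← mul_add, log_mul (by norm_num) h0.ne']
      ring
  push_cast at a1 a2 a3 a4 b1 b2 b3 b4
  rw [e1] at a4 b4
  rw [e2] at a1 b1
  rw [e, abs_le]
  unfold rate stirlingError
  constructor <;> linarith

lemma abs_log_prod_revRatio_sub_sum_rate_le (m p : ℕ) :
    |log (∏ q ∈ Finset.range p, revRatio m q : ℚ) - ∑ q ∈ Finset.range p, rate m q|
      ≤ p * stirlingError (m + p) := by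
  have e : log (∏ q ∈ Finset.range p, revRatio m q : ℚ) =
      ∑ q ∈ Finset.range p, log (revRatio m q : ℚ) := by
    push_cast
    exact log_prod fun q _ => by exact_mod_cast (revRatio_pos m q).ne'
  rw [e, ← Finset.sum_sub_distrib]
  refine (Finset.abs_sum_le_sum_abs _ _).trans ?_
  refine (Finset.sum_le_card_nsmul _ _ (stirlingError (m + p)) fun q hq => ?_).trans ?_
  · rw [Finset.mem_range] at hq
    exact abs_log_revRatio_sub_rate_le (by omega)
  · simp

lemma log_prod_revRatio_le (m : ℕ) {p : ℕ} (hp : 0 < p) :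
    log (∏ q ∈ Finset.range p, revRatio m q : ℚ) ≤
      ((m + p : ℕ) : ℝ) ^ 2 * f (m / (m + p : ℕ)) + p * stirlingError (m + p) := by
  have hm : (0 : ℝ) ≤ m := by positivity
  have h1 := ratePrimitive_eq hm (show (0 : ℝ) < p by exact_mod_cast hp)
  have h2 := sum_rate_le hm p
  have h3 := (abs_le.1 (abs_log_prod_revRatio_sub_sum_rate_le m p)).2
  rw [Nat.cast_add, ← h1]
  linarith

lemma le_log_prod_revRatio (m : ℕ) {p : ℕ} (hp : 0 < p) :
    ((m + p : ℕ) : ℝ) ^ 2 * f (m / (m + p : ℕ)) - 2 * m - p * stirlingError (m + p) ≤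
      log (∏ q ∈ Finset.range p, revRatio m q : ℚ) := by
  have hm : (0 : ℝ) ≤ m := by positivity
  have h1 := ratePrimitive_eq hm (show (0 : ℝ) < p by exact_mod_cast hp)
  have h2 := le_sum_rate hm p
  have h3 := (abs_le.1 (abs_log_prod_revRatio_sub_sum_rate_le m p)).1
  rw [Nat.cast_add, ← h1]
  linarith

end BlockAsymptotics

end Layered

namespace Layered

open Real

lemma log_upsilon_append (b : List ℕ) {c : ℕ} (hb : ∀ x ∈ b, 0 < x) (hc : 0 < c) :
    log (Upsilon (b ++ [c]).sum (layeredPerm (b ++ [c])) : ℚ) =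
      log (Upsilon b.sum (layeredPerm b) : ℚ) +
        log (∏ q ∈ Finset.range c, revRatio b.sum q : ℚ) := by
  rw [upsilon_layeredPerm_append b hc, Rat.cast_mul, log_mul]
  · exact_mod_cast (upsilon_layeredPerm_pos b hb).ne'
  · exact_mod_cast (Finset.prod_pos fun q _ => revRatio_pos b.sum q).ne'

lemma log_upsilon_layeredPerm_le {γ : ℝ}
    (hγ : ∀ x ∈ Set.Icc (0 : ℝ) 1, f x ≤ γ * (1 - x ^ 2)) (b : List ℕ) (hb : ∀ c ∈ b, 0 < c) :
    log (Upsilon b.sum (layeredPerm b) : ℚ) ≤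
      γ * (b.sum : ℝ) ^ 2 + b.sum * stirlingError b.sum := by
  induction b using List.reverseRecOn with
  | nil => simp [upsilon_layeredPerm_nil]
  | append_singleton b c ih =>
    have hb' : ∀ x ∈ b, 0 < x := fun x hx => hb x (by simp [hx])
    have hc : 0 < c := hb c (by simp)
    rw [log_upsilon_append b hb' hc, List.sum_append, List.sum_singleton]
    have h1 := ih hb'
    generalize b.sum = m at *
    have h2 := log_prod_revRatio_le m hc
    have hn : (0 : ℝ) < (m + c : ℕ) := by positivity
    have h3 := hγ (m / (m + c : ℕ)) ⟨by positivity, by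
      rw [div_le_one hn]
      exact_mod_cast Nat.le_add_right m c⟩
    have h4 := mul_le_mul_of_nonneg_left h3 (sq_nonneg ((m + c : ℕ) : ℝ))
    have h5 : ((m + c : ℕ) : ℝ) ^ 2 * (γ * (1 - (m / (m + c : ℕ)) ^ 2)) =
        γ * ((m + c : ℕ) : ℝ) ^ 2 - γ * (m : ℝ) ^ 2 := by
      field_simp
    have h6 : (m : ℝ) * stirlingError m ≤ m * stirlingError (m + c) := by
      gcongr
      exact stirlingError_mono (Nat.le_add_right m c)
    have h7 : ((m + c : ℕ) : ℝ) * stirlingError (m + c) =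
        m * stirlingError (m + c) + c * stirlingError (m + c) := by
      push_cast
      ring
    linarith

lemma revRatio_zero_left (q : ℕ) : revRatio 0 q = 1 := by
  unfold revRatio
  simp only [mul_zero, zero_add]
  rw [mul_comm]
  exact div_self (by positivity)

lemma exists_log_upsilon_eq_zero (n : ℕ) :
    ∃ b : List ℕ, (∀ c ∈ b, 0 < c) ∧ b.sum = n ∧ log (Upsilon n (layeredPerm b) : ℚ) = 0 := by
  rcases Nat.eq_zero_or_pos n with rfl | hn
  · exact ⟨[], by simp, by simp, by simp [upsilon_layeredPerm_nil]⟩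
  · refine ⟨[n], by simpa using hn, by simp, ?_⟩
    have := log_upsilon_append [] (by simp) hn
    simpa [upsilon_layeredPerm_nil, revRatio_zero_left] using this

lemma exists_le_log_upsilon {α : ℝ} (hα : α ∈ Set.Ioo (0 : ℝ) 1) :
    ∃ K : ℝ, 0 ≤ K ∧ ∀ n : ℕ, ∃ b : List ℕ, (∀ c ∈ b, 0 < c) ∧ b.sum = n ∧
      f α / (1 - α ^ 2) * (n : ℝ) ^ 2 - K * n * stirlingError n ≤
        log (Upsilon n (layeredPerm b) : ℚ) := by
  set γ := f α / (1 - α ^ 2) with hγ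
  set φ : ℝ → ℝ := fun x => γ * x ^ 2 + f x with hφ
  have hφα : φ α = γ := by
    have : 1 - α ^ 2 ≠ 0 := by nlinarith [hα.1, hα.2]
    simp only [hφ, hγ]
    field_simp
    ring
  have hd : DifferentiableAt ℝ φ α :=
    ((differentiableAt_id.pow 2).const_mul γ).add (hasDerivAt_f α).differentiableAt
  obtain ⟨L, hL0, hL⟩ := hd.hasDerivAt.isBigO_sub.exists_pos
  rw [Asymptotics.isBigOWith_iff, Metric.eventually_nhds_iff] at hL
  obtain ⟨δ, hδ, hL⟩ := hL
  obtain ⟨N, hN⟩ := exists_nat_gt (1 / δ)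
  set K := |γ| * N + (L + 4) / (1 - α) with hK
  have hα1 : 0 < 1 - α := by linarith [hα.2]
  have hK0 : 0 ≤ K := by positivity
  refine ⟨K, hK0, fun n => ?_⟩
  induction n using Nat.strong_induction_on with
  | _ n ih =>
  have herr := two_le_stirlingError n
  have hn0 : (0 : ℝ) ≤ n := by positivity
  rcases le_total n N with hnN | hnN
  · obtain ⟨b, hb, hs, h⟩ := exists_log_upsilon_eq_zero n
    refine ⟨b, hb, hs, ?_⟩
    rw [h]
    have h1 : γ * (n : ℝ) ^ 2 ≤ |γ| * n * N := by
      have : (n : ℝ) ≤ N := by exact_mod_cast hnN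
      calc γ * (n : ℝ) ^ 2 ≤ |γ| * (n : ℝ) ^ 2 := by gcongr; exact le_abs_self γ
        _ = |γ| * n * n := by ring
        _ ≤ _ := by gcongr
    have h2 : |γ| * N * n * 1 ≤ K * n * stirlingError n := by
      gcongr
      · rw [hK]
        have : 0 ≤ (L + 4) / (1 - α) := by positivity
        linarith
      · linarith
    linarith
  · have hNn : 1 / δ < n := hN.trans_le (by exact_mod_cast hnN)
    have hnpos : (0 : ℝ) < n := (by positivity : 0 < 1 / δ).trans hNn
    have hinv : 1 / (n : ℝ) < δ := (one_div_lt hδ hnpos).1 hNn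
    set m := ⌊α * n⌋₊ with hm
    have hm1 : (m : ℝ) ≤ α * n := Nat.floor_le (by have := hα.1; positivity)
    have hm2 : α * n < m + 1 := Nat.lt_floor_add_one _
    have hmn : m < n := by
      have : (m : ℝ) < n := by nlinarith
      exact_mod_cast this
    obtain ⟨b, hb, hs, h⟩ := ih m hmn
    obtain ⟨p, hp, hnp⟩ : ∃ p, 0 < p ∧ n = m + p := ⟨n - m, by omega, by omega⟩
    have hnp' : (n : ℝ) = m + p := by exact_mod_cast hnp
    refine ⟨b ++ [p], ?_, by simp [hs, hnp], ?_⟩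
    · intro x hx
      rcases List.mem_append.1 hx with hx | hx
      · exact hb x hx
      · rwa [List.mem_singleton.1 hx]
    have e := log_upsilon_append b hb hp
    rw [List.sum_append, List.sum_singleton, hs, ← hnp] at e
    rw [e]
    have h1 := le_log_prod_revRatio m hp
    rw [← hnp] at h1
    have hEm := stirlingError_mono hmn.le
    set E := stirlingError n
    have hdist : |(m : ℝ) / n - α| ≤ 1 / n := by
      rw [abs_le]
      constructor
      · rw [← sub_nonneg]
        have : (m : ℝ) / n - α - -(1 / n) = (m + 1 - α * n) / n := by field_simp; ring
        rw [this]
        exact div_nonneg (by linarith) hn0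
      · have : (m : ℝ) / n ≤ α := by rwa [div_le_iff₀ hnpos]
        have : 0 < 1 / (n : ℝ) := by positivity
        linarith
    have h2 := hL (y := (m : ℝ) / n) (by rw [Real.dist_eq]; linarith)
    rw [hφα, Real.norm_eq_abs, Real.norm_eq_abs] at h2
    have h3 : γ - L * (1 / n) ≤ φ (m / n) := by
      have := (abs_le.1 (h2.trans (mul_le_mul_of_nonneg_left hdist hL0.le))).1
      linarith
    have h4 := mul_le_mul_of_nonneg_left h3 (sq_nonneg (n : ℝ))
    have h5 : (n : ℝ) ^ 2 * (γ - L * (1 / n)) = γ * n ^ 2 - L * n := by field_simp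
    have h6 : (n : ℝ) ^ 2 * φ (m / n) = γ * m ^ 2 + n ^ 2 * f (m / n) := by
      simp only [hφ]
      field_simp
    have h7 : K * m * stirlingError m ≤ K * m * E := by gcongr
    have h8 : K * m * E ≤ K * (α * n) * E := by gcongr
    have hpn : (p : ℝ) ≤ n := by linarith [show (0 : ℝ) ≤ m by positivity]
    have hmn' : (m : ℝ) ≤ n := by linarith [show (0 : ℝ) ≤ p by positivity]
    have h9 : p * E ≤ n * E := by gcongr
    have h10 : L + 4 ≤ K * (1 - α) := by
      have : (L + 4) / (1 - α) ≤ K := by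
        rw [hK]
        have : 0 ≤ |γ| * N := by positivity
        linarith
      rwa [div_le_iff₀ hα1] at this
    have h11 : (L + 4) * (n * E) ≤ K * (1 - α) * (n * E) := by gcongr
    have h12 : (L + 2) * n * 1 ≤ (L + 3) * n * E := by gcongr <;> linarith
    linarith

lemma tendsto_stirlingError_div :
    Filter.Tendsto (fun n : ℕ => stirlingError n / n) Filter.atTop (nhds 0) := by
  have h1 : Filter.Tendsto (fun n : ℕ => (2 : ℝ) / n) Filter.atTop (nhds 0) :=
    tendsto_const_div_atTop_nhds_zero_nat 2
  have h2 : Filter.Tendsto (fun n : ℕ => 2 * (n : ℝ) + 1) Filter.atTop Filter.atTop :=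
    Filter.tendsto_atTop_add_const_right _ _
      (tendsto_natCast_atTop_atTop.const_mul_atTop two_pos)
  have h3 := (tendsto_pow_log_div_mul_add_atTop (1 / 2) (-1 / 2) 1 (by norm_num)).comp h2
  have h4 := h1.add (h3.const_mul 2)
  rw [mul_zero, add_zero] at h4
  refine h4.congr fun n => ?_
  have e : (1 / 2 : ℝ) * (2 * n + 1) + -1 / 2 = n := by ring
  simp only [Function.comp, e, pow_one, stirlingError]
  ring

lemma tendsto_log_v {α : ℝ} (hα : α ∈ Set.Ioo (0 : ℝ) 1)
    (hγ : ∀ x ∈ Set.Icc (0 : ℝ) 1, f x ≤ f α / (1 - α ^ 2) * (1 - x ^ 2)) :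
    Filter.Tendsto (fun n : ℕ => (1 / (n : ℝ) ^ 2) * log (v n)) Filter.atTop
      (nhds (f α / (1 - α ^ 2))) := by
  obtain ⟨K, hK0, hK⟩ := exists_le_log_upsilon hα
  set γ := f α / (1 - α ^ 2)
  have hle : ∀ n, ∀ x ∈ (fun w => ((Upsilon n w : ℚ) : ℝ)) '' LayeredSet n,
      x ≤ exp (γ * (n : ℝ) ^ 2 + n * stirlingError n) := by
    rintro n _ ⟨_, ⟨b, hb, rfl, rfl⟩, rfl⟩
    have h0 : (0 : ℝ) < (Upsilon b.sum (layeredPerm b) : ℚ) := by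
      exact_mod_cast upsilon_layeredPerm_pos b hb
    rw [← log_le_iff_le_exp h0]
    exact log_upsilon_layeredPerm_le hγ b hb
  have hmain : ∀ n : ℕ, γ * (n : ℝ) ^ 2 - K * n * stirlingError n ≤ log (v n) ∧
      log (v n) ≤ γ * (n : ℝ) ^ 2 + n * stirlingError n := fun n => by
    obtain ⟨b, hb, rfl, h⟩ := hK n
    have h0 : (0 : ℝ) < (Upsilon b.sum (layeredPerm b) : ℚ) := by
      exact_mod_cast upsilon_layeredPerm_pos b hb
    have hmem : ((Upsilon b.sum (layeredPerm b) : ℚ) : ℝ) ∈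
        (fun w => ((Upsilon b.sum w : ℚ) : ℝ)) '' LayeredSet b.sum :=
      ⟨_, ⟨b, hb, rfl, rfl⟩, rfl⟩
    have h1 : ((Upsilon b.sum (layeredPerm b) : ℚ) : ℝ) ≤ v b.sum :=
      le_csSup ⟨_, hle _⟩ hmem
    exact ⟨h.trans (log_le_log h0 h1),
      (log_le_iff_le_exp (h0.trans_le h1)).2 (csSup_le ⟨_, hmem⟩ (hle _))⟩
  have ht := tendsto_stirlingError_div
  have hlow := (ht.const_mul K).const_sub γ
  have hup := ht.const_add γ
  rw [mul_zero, sub_zero] at hlow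
  rw [add_zero] at hup
  refine tendsto_of_tendsto_of_tendsto_of_le_of_le' hlow hup ?_ ?_ <;>
    filter_upwards [Filter.eventually_gt_atTop 0] with n hn
  · have hn' : (0 : ℝ) < n := by exact_mod_cast hn
    rw [one_div, inv_mul_eq_div, le_div_iff₀ (by positivity)]
    refine le_trans (le_of_eq ?_) (hmain n).1
    field_simp
  · have hn' : (0 : ℝ) < n := by exact_mod_cast hn
    rw [one_div, inv_mul_eq_div, div_le_iff₀ (by positivity)]
    refine (hmain n).2.trans (le_of_eq ?_)
    field_simp

end Layered

/-- The limit `lim_{n→∞} (1/n²) log v(n)` exists and equals `γ = f(α)/(1−α²)`,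
where `α` is the unique solution in `(0,1)` of `2x·f(x) + (1−x²)·f′(x) = 0`. -/
theorem limit_log_v (α : ℝ) (hα : α ∈ Set.Ioo (0 : ℝ) 1)
    (hroot : 2 * α * f α + (1 - α ^ 2) * deriv f α = 0)
    (huniq : ∀ β ∈ Set.Ioo (0 : ℝ) 1,
      2 * β * f β + (1 - β ^ 2) * deriv f β = 0 → β = α) :
    Filter.Tendsto (fun n : ℕ => (1 / (n : ℝ) ^ 2) * Real.log (v n)) Filter.atTop
      (nhds (f α / (1 - α ^ 2))) := by
  exact Layered.tendsto_log_v hα fun x hx => Layered.f_le_of_unique_critical huniq hx
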